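/- For every integer n ≥ 71, the first-order forward difference of the partition function satisfies the Turán inequality: (Δp(n))^2 > (Δp(n-1))·(Δp(n+1)). -/

import Mathlib

/-- The partition function: the number of partitions of `n`. -/
def partitionFn (n : ℕ) : ℕ := Fintype.card (Nat.Partition n)

/-- The first-order forward difference of the partition function, as an integer. -/
def dP (n : ℕ) : ℤ := (partitionFn (n + 1) : ℤ) - partitionFn n

open Finset Real Filter Topology

section GeneratingFunctions

open PowerSeries PowerSeries.WithPiTopology Nat.Partition

/-- The series `∑ X ^ (k j)`, generating the partitions whose parts are all equal to `k`. -/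
noncomputable def geoSeries (R : Type*) [CommRing R] (k : ℕ) : PowerSeries R :=
  PowerSeries.mk fun n ↦ if k ∣ n then 1 else 0

theorem geoSeries_mul_one_sub (R : Type*) [CommRing R] {k : ℕ} (hk : 0 < k) :
    geoSeries R k * (1 - X ^ k) = 1 := by
  ext n
  rw [mul_sub, mul_one, map_sub, coeff_mul_X_pow', coeff_one]
  simp only [geoSeries, coeff_mk]
  rcases Nat.eq_zero_or_pos n with rfl | hn
  · simp [hk.ne']
  · rw [if_neg hn.ne']
    by_cases h : k ≤ n
    · have : k ∣ n - k ↔ k ∣ n := by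
        conv_rhs => rw [← Nat.sub_add_cancel h]
        exact (Nat.dvd_add_self_right).symm
      simp [h, this]
    · have : ¬ k ∣ n := fun hd ↦ h (Nat.le_of_dvd hn hd)
      simp [h, this]

theorem geoSeries_eq_tsum (R : Type*) [CommRing R] [TopologicalSpace R] [IsTopologicalRing R]
    [T2Space R] (i : ℕ) :
    ∑' j : ℕ, (X : PowerSeries R) ^ ((i + 1) * j) = geoSeries R (i + 1) := by
  have h1 : (∑' j : ℕ, (X : PowerSeries R) ^ ((i + 1) * j)) * (1 - X ^ (i + 1)) = 1 := by
    simp_rw [pow_mul]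
    exact tsum_pow_mul_one_sub_of_constantCoeff_eq_zero (by simp)
  have h2 := geoSeries_mul_one_sub R (Nat.succ_pos i)
  calc _ = (∑' j : ℕ, (X : PowerSeries R) ^ ((i + 1) * j)) *
        (geoSeries R (i + 1) * (1 - X ^ (i + 1))) := by rw [h2, mul_one]
    _ = geoSeries R (i + 1) *
        ((∑' j : ℕ, (X : PowerSeries R) ^ ((i + 1) * j)) * (1 - X ^ (i + 1))) := by ring
    _ = _ := by rw [h1, mul_one]

theorem mk_card_restricted_eq_prod (R : Type*) [CommRing R] (p : ℕ → Prop) [DecidablePred p]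
    (s : Finset ℕ) (hs : ∀ i, p (i + 1) ↔ i ∈ s) :
    (PowerSeries.mk fun n ↦ ((restricted n p).card : R)) = ∏ i ∈ s, geoSeries R (i + 1) := by
  let _ : TopologicalSpace R := ⊥
  have _ : DiscreteTopology R := ⟨rfl⟩
  have h := hasProd_powerSeriesMk_card_restricted R p
  have h2 := hasProd_prod_of_ne_finset_one (s := s) (L := SummationFilter.unconditional ℕ)
    (f := fun i ↦ if p (i + 1) then ∑' j : ℕ, (X : PowerSeries R) ^ ((i + 1) * j) else 1)
    (fun i hi ↦ if_neg fun hp ↦ hi ((hs i).1 hp))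
  rw [h.unique h2]
  refine Finset.prod_congr rfl fun i hi ↦ ?_
  rw [if_pos ((hs i).2 hi), geoSeries_eq_tsum]

/-- The number of partitions of `n` into parts between `2` and `L`. -/
def cardParts (L n : ℕ) : ℕ := (restricted n fun i ↦ 2 ≤ i ∧ i ≤ L).card

theorem mk_cardParts (R : Type*) [CommRing R] (L : ℕ) :
    (PowerSeries.mk fun n ↦ (cardParts L n : R)) = ∏ i ∈ Ico 1 L, geoSeries R (i + 1) :=
  mk_card_restricted_eq_prod R _ _ fun i ↦ by rw [mem_Ico]; omega

theorem card_restricted_le {L n : ℕ} (h : n ≤ L) :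
    (restricted n fun i ↦ i ≤ L).card = partitionFn n := by
  rw [restricted, filter_true_of_mem, partitionFn, card_univ]
  exact fun p _ i hi ↦ (p.le_of_mem_parts hi).trans h

theorem mk_card_restricted_le (R : Type*) [CommRing R] (L : ℕ) :
    (PowerSeries.mk fun n ↦ ((restricted n fun i ↦ i ≤ L).card : R)) =
      ∏ i ∈ range L, geoSeries R (i + 1) :=
  mk_card_restricted_eq_prod R _ _ fun i ↦ by rw [mem_range]; omega

theorem dP_eq_cardParts {L n : ℕ} (h : n + 1 ≤ L) : dP n = cardParts L (n + 1) := by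
  have h1 : (PowerSeries.mk fun n ↦ (cardParts L n : ℤ)) =
      (PowerSeries.mk fun n ↦ ((restricted n fun i ↦ i ≤ L).card : ℤ)) * (1 - X) := by
    have hg := geoSeries_mul_one_sub ℤ one_pos
    rw [pow_one] at hg
    rw [mk_cardParts, mk_card_restricted_le, range_eq_Ico, prod_eq_prod_Ico_succ_bot (show 0 < L by omega),
      zero_add, mul_right_comm, hg, one_mul]
  have h2 := congrArg (coeff (n + 1)) h1
  rw [mul_sub, mul_one, map_sub, coeff_succ_mul_X, coeff_mk, coeff_mk, coeff_mk,
    card_restricted_le h, card_restricted_le (by omega)] at h2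
  rw [h2, dP]

end GeneratingFunctions

section Computation

/-- Continue with the evaluated numeral `n`; this keeps kernel reduction from piling up
unevaluated terms. -/
def forceNat {α : Sort*} (n : ℕ) (f : ℕ → α) : α :=
  Nat.rec (f 0) (fun m _ ↦ f (m + 1)) n

/-- The first `4 * j` terms of the pentagonal number series at `2 ^ w`. -/
def packedPentagonal (w j : ℕ) : ℕ :=
  Nat.rec 0
    (fun i E ↦ (E + 2 ^ (w * (i * (6 * i + 1))) + 2 ^ (w * ((i + 1) * (6 * i + 5)))) -
      (2 ^ (w * ((2 * i + 1) * (3 * i + 1))) + 2 ^ (w * ((2 * i + 1) * (3 * i + 2))))) j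

/-- Newton iteration for the inverse of `E` modulo `2 ^ (w * 2 ^ j)`. -/
def packedInv (w E j : ℕ) : ℕ :=
  Nat.rec 1 (fun i X ↦ forceNat (2 ^ (w * 2 ^ (i + 1)) - 1) fun mask ↦ forceNat X fun Y ↦
    (Y * ((mask - (((E &&& mask) * Y) &&& mask) + 3) &&& mask)) &&& mask) j

/-- The inequality for the differences of four consecutive terms `a`, `b`, `c`, `d`. -/
def turanTest (a b c d : ℕ) : Bool :=
  Nat.blt (b * c + b * d + a * c) (c * c + b * b + a * d)

/-- The inequality for all windows of base `2 ^ w` digits of `X` with initial position less than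
`2 ^ j` and at most `m - a - 4`. -/
def packedTest (w m j : ℕ) : ℕ → ℕ → Bool :=
  Nat.rec
    (fun a X ↦ (Nat.ble m (a + 3)).or (turanTest (X &&& (2 ^ w - 1)) ((X >>> w) &&& (2 ^ w - 1))
      ((X >>> (w * 2)) &&& (2 ^ w - 1)) ((X >>> (w * 3)) &&& (2 ^ w - 1))))
    (fun i ih a X ↦ (ih a (X &&& (2 ^ (w * (2 ^ i + 3)) - 1))).and
      (ih (a + 2 ^ i) (X >>> (w * 2 ^ i)))) j

/-- The complete computation: the inverse of the pentagonal number series at `2 ^ w`, modulo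
`2 ^ (w * m)`, has digits which pass the test from index `a` on. -/
def packedCheck (w m i j a : ℕ) : Bool :=
  forceNat (2 ^ (w * m) - 1) fun mask ↦
    forceNat (packedPentagonal w i) fun E ↦
      forceNat (packedInv w E j &&& mask) fun X ↦
        (Nat.beq ((E * X) &&& mask) 1).and (packedTest w m j a (X >>> (w * a)))

theorem forceNat_eq {α : Sort*} (n : ℕ) (f : ℕ → α) : forceNat n f = f n := by
  cases n <;> rfl

theorem packedPentagonal_succ (w j : ℕ) : packedPentagonal w (j + 1) =
    (packedPentagonal w j + 2 ^ (w * (j * (6 * j + 1))) + 2 ^ (w * ((j + 1) * (6 * j + 5)))) -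
      (2 ^ (w * ((2 * j + 1) * (3 * j + 1))) + 2 ^ (w * ((2 * j + 1) * (3 * j + 2)))) :=
  rfl

theorem pentagonal_neg_natCast (k : ℕ) : pentagonal (-(k : ℤ)) = k * (3 * k + 1) / 2 := by
  rw [pentagonal_neg]
  norm_cast

theorem pentagonal_natCast_add_one (k : ℕ) :
    pentagonal ((k : ℤ) + 1) = (k + 1) * (3 * k + 2) / 2 := by
  rw [pentagonal_def, show ((k : ℤ) + 1) * (3 * (k + 1) - 1) = ((k + 1) * (3 * k + 2) : ℕ) by
    push_cast; ring]
  norm_cast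

open Polynomial in
/-- The pentagonal number series up to `2 * K` terms. -/
noncomputable def pentagonalPoly (K : ℕ) : ℤ[X] :=
  ∑ k ∈ range K, (-1) ^ k * (X ^ pentagonal (-(k : ℤ)) - X ^ pentagonal ((k : ℤ) + 1))

theorem cast_packedPentagonal {w : ℕ} (hw : 0 < w) (j : ℕ) :
    ((packedPentagonal w j : ℕ) : ℤ) = (pentagonalPoly (2 * j)).eval (2 ^ w) := by
  induction j with
  | zero => simp [packedPentagonal, pentagonalPoly]
  | succ j ih =>
    have h1 : pentagonal (-((2 * j : ℕ) : ℤ)) = j * (6 * j + 1) := by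
      rw [pentagonal_neg_natCast]
      apply Nat.div_eq_of_eq_mul_left two_pos; ring
    have h2 : pentagonal (((2 * j : ℕ) : ℤ) + 1) = (2 * j + 1) * (3 * j + 1) := by
      rw [pentagonal_natCast_add_one]
      apply Nat.div_eq_of_eq_mul_left two_pos; ring
    have h3 : pentagonal (-((2 * j + 1 : ℕ) : ℤ)) = (2 * j + 1) * (3 * j + 2) := by
      rw [pentagonal_neg_natCast]
      apply Nat.div_eq_of_eq_mul_left two_pos; ring
    have h4 : pentagonal (((2 * j + 1 : ℕ) : ℤ) + 1) = (j + 1) * (6 * j + 5) := by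
      rw [pentagonal_natCast_add_one]
      apply Nat.div_eq_of_eq_mul_left two_pos; ring
    have hle : 2 ^ (w * ((2 * j + 1) * (3 * j + 1))) + 2 ^ (w * ((2 * j + 1) * (3 * j + 2))) ≤
        packedPentagonal w j + 2 ^ (w * (j * (6 * j + 1))) +
          2 ^ (w * ((j + 1) * (6 * j + 5))) := by
      have e1 : 2 ^ (w * ((2 * j + 1) * (3 * j + 1))) ≤ 2 ^ (w * ((2 * j + 1) * (3 * j + 2))) :=
        Nat.pow_le_pow_right two_pos (Nat.mul_le_mul_left _ (Nat.mul_le_mul_left _ (by omega)))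
      have e2 : 2 ^ (w * ((2 * j + 1) * (3 * j + 2)) + 1) ≤ 2 ^ (w * ((j + 1) * (6 * j + 5))) := by
        refine Nat.pow_le_pow_right two_pos ?_
        have : (j + 1) * (6 * j + 5) = (2 * j + 1) * (3 * j + 2) + (4 * j + 3) := by ring
        rw [this, Nat.mul_add w]
        exact Nat.add_le_add_left (Nat.mul_pos hw (by omega)) _
      rw [pow_succ] at e2
      refine le_trans ?_ (Nat.le_add_left _ _)
      linarith
    rw [packedPentagonal_succ, Nat.cast_sub hle, show 2 * (j + 1) = 2 * j + 1 + 1 by ring,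
      pentagonalPoly, sum_range_succ, sum_range_succ, h1, h2, h3, h4, ← pentagonalPoly]
    push_cast
    rw [ih]
    simp only [Polynomial.eval_add, Polynomial.eval_mul, Polynomial.eval_pow, Polynomial.eval_neg,
      Polynomial.eval_one, Polynomial.eval_sub, Polynomial.eval_X, pow_mul, pow_succ]
    ring

section
open PowerSeries PowerSeries.WithPiTopology

theorem hasSum_partitionFn_mul_pentagonal :
    HasSum (fun k : ℕ ↦ (PowerSeries.mk fun n ↦ (partitionFn n : ℤ)) *
      ((-1) ^ k * (X ^ pentagonal (-(k : ℤ)) - X ^ pentagonal ((k : ℤ) + 1)))) 1 := by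
  have h1 := Nat.Partition.hasProd_powerSeriesMk_card_restricted ℤ (fun _ ↦ True)
  have hmk : (PowerSeries.mk fun n ↦ ((Nat.Partition.restricted n fun _ ↦ True).card : ℤ)) =
      PowerSeries.mk fun n ↦ (partitionFn n : ℤ) := by
    ext n
    rw [coeff_mk, coeff_mk, Nat.Partition.restricted, filter_true_of_mem (fun _ _ _ _ ↦ trivial),
      card_univ, partitionFn]
  rw [hmk] at h1
  have h2 := h1.mul (hasProd_one_sub_X_pow ℤ)
  have hf : (fun i : ℕ ↦ (if True then ∑' j : ℕ, (X : PowerSeries ℤ) ^ ((i + 1) * j) else 1) *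
      (1 - X ^ (i + 1))) = fun _ ↦ 1 := by
    funext i
    rw [if_pos trivial, geoSeries_eq_tsum, geoSeries_mul_one_sub ℤ i.succ_pos]
  rw [hf] at h2
  have h3 := h2.unique hasProd_one
  have h4 := (hasSum_pow_pentagonal_sub_pentagonalSeries ℤ).mul_left
    (PowerSeries.mk fun n ↦ (partitionFn n : ℤ))
  rwa [h3] at h4

theorem coeff_partitionFn_mul_pentagonal {K M n : ℕ} (hK : M ≤ K * (3 * K + 1) / 2) (hn : n < M) :
    coeff n ((PowerSeries.mk fun n ↦ (partitionFn n : ℤ)) * (pentagonalPoly K : PowerSeries ℤ)) =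
      coeff n (1 : PowerSeries ℤ) := by
  have h := (hasSum_partitionFn_mul_pentagonal.map (coeff n) (continuous_coeff ℤ n))
  refine HasSum.unique ?_ h
  have : coeff n ((PowerSeries.mk fun n ↦ (partitionFn n : ℤ)) *
      (pentagonalPoly K : PowerSeries ℤ)) = ∑ k ∈ range K, coeff n ((PowerSeries.mk fun n ↦
      (partitionFn n : ℤ)) *
      ((-1) ^ k * (X ^ pentagonal (-(k : ℤ)) - X ^ pentagonal ((k : ℤ) + 1)))) := by
    rw [← map_sum, ← mul_sum, pentagonalPoly, ← Polynomial.coeToPowerSeries.ringHom_apply, map_sum]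
    simp
  rw [this]
  refine hasSum_sum_of_ne_finset_zero fun k hk ↦ ?_
  rw [mem_range, not_lt] at hk
  have hmono : K * (3 * K + 1) / 2 ≤ k * (3 * k + 1) / 2 := by gcongr
  have hmono2 : k * (3 * k + 1) / 2 ≤ (k + 1) * (3 * k + 2) / 2 := by gcongr <;> omega
  have hd : (X : PowerSeries ℤ) ^ M ∣ (PowerSeries.mk fun n ↦ (partitionFn n : ℤ)) *
      ((-1) ^ k * (X ^ pentagonal (-(k : ℤ)) - X ^ pentagonal ((k : ℤ) + 1))) := by
    rw [pentagonal_neg_natCast, pentagonal_natCast_add_one]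
    refine Dvd.dvd.mul_left (Dvd.dvd.mul_left (dvd_sub ?_ ?_) _) _ <;>
    exact pow_dvd_pow _ (by omega)
  exact X_pow_dvd_iff.1 hd n hn

theorem pow_dvd_sum_partitionFn_mul_sub_one {K M : ℕ} (hK : M ≤ K * (3 * K + 1) / 2) (b : ℤ) :
    b ^ M ∣ (∑ i ∈ range M, (partitionFn i : ℤ) * b ^ i) * (pentagonalPoly K).eval b - 1 := by
  have hd : (Polynomial.X : Polynomial ℤ) ^ M ∣
      trunc M (PowerSeries.mk fun n ↦ (partitionFn n : ℤ)) * pentagonalPoly K - 1 := by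
    rw [Polynomial.X_pow_dvd_iff]
    intro d hd
    rw [Polynomial.coeff_sub, sub_eq_zero, ← Polynomial.coeff_coe, ← Polynomial.coeff_coe,
      Polynomial.coe_mul, Polynomial.coe_one, ← coeff_partitionFn_mul_pentagonal hK hd]
    rw [coeff_mul, coeff_mul]
    refine sum_congr rfl fun x hx ↦ ?_
    rw [Polynomial.coeff_coe, coeff_trunc, if_pos]
    have := mem_antidiagonal.1 hx
    omega
  obtain ⟨q, hq⟩ := hd
  refine ⟨q.eval b, ?_⟩
  have := congrArg (Polynomial.eval b) hq
  rw [Polynomial.eval_sub, Polynomial.eval_mul, Polynomial.eval_mul, Polynomial.eval,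
    Polynomial.eval, eval₂_trunc_eq_sum_range] at this
  simpa using this
end

theorem sum_mul_pow_lt {b : ℕ} {c : ℕ → ℕ} (m : ℕ) (hc : ∀ i < m, c i < b) :
    ∑ i ∈ range m, c i * b ^ i < b ^ m := by
  induction m with
  | zero => simp
  | succ m ih =>
    rw [sum_range_succ, pow_succ]
    have h1 := ih fun i hi ↦ hc i (by omega)
    have h2 := Nat.mul_le_mul_right (b ^ m) (hc m (by omega))
    rw [Nat.succ_mul] at h2
    linarith [mul_comm b (b ^ m)]

theorem sum_mul_pow_div_mod {b : ℕ} {c : ℕ → ℕ} {m j : ℕ} (hc : ∀ i < m, c i < b) (hj : j < m) :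
    (∑ i ∈ range m, c i * b ^ i) / b ^ j % b = c j := by
  have hb : 0 < b := (Nat.zero_le _).trans_lt (hc j hj)
  obtain ⟨t, rfl⟩ := Nat.exists_eq_add_of_lt hj
  rw [show j + t + 1 = j + (t + 1) by ring, sum_range_add, sum_range_succ']
  have h1 := sum_mul_pow_lt j fun i hi ↦ hc i (by omega)
  have h2 : ∑ i ∈ range t, c (j + (i + 1)) * b ^ (j + (i + 1)) =
      b ^ j * (b * ∑ i ∈ range t, c (j + (i + 1)) * b ^ i) := by
    rw [mul_sum, mul_sum]
    exact sum_congr rfl fun i _ ↦ by ring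
  rw [h2, add_zero, mul_comm (c j), ← mul_add, Nat.add_mul_div_left _ _ (pow_pos hb j),
    Nat.div_eq_of_lt h1, zero_add, Nat.mul_add_mod, Nat.mod_eq_of_lt (hc j hj)]

theorem partitionFn_lt {w i : ℕ} (h : i ≤ w) : partitionFn i < 2 ^ w ∨ w = 0 := by
  rcases Nat.eq_zero_or_pos w with h0 | h0
  · exact Or.inr h0
  refine Or.inl ?_
  have h1 : partitionFn i ≤ 2 ^ (i - 1) := by
    rw [← composition_card, partitionFn]
    exact Fintype.card_le_of_surjective _ Nat.Partition.ofComposition_surj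
  exact h1.trans_lt (Nat.pow_lt_pow_right one_lt_two (by omega))

theorem packedTest_succ (w m j a X : ℕ) : packedTest w m (j + 1) a X =
    ((packedTest w m j a (X &&& (2 ^ (w * (2 ^ j + 3)) - 1))).and
      (packedTest w m j (a + 2 ^ j) (X >>> (w * 2 ^ j)))) :=
  rfl

theorem packedTest_sound {w m : ℕ} (j : ℕ) : ∀ {a X : ℕ}, packedTest w m j a X = true →
    ∀ i < 2 ^ j, a + i + 3 < m → turanTest (X / (2 ^ w) ^ i % 2 ^ w)
      (X / (2 ^ w) ^ (i + 1) % 2 ^ w) (X / (2 ^ w) ^ (i + 2) % 2 ^ w)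
      (X / (2 ^ w) ^ (i + 3) % 2 ^ w) = true := by
  induction j with
  | zero =>
    intro a X h i hi hm
    obtain rfl : i = 0 := by simpa using hi
    change (_ || _) = true at h
    simp only [Nat.and_two_pow_sub_one_eq_mod, Bool.or_eq_true, Nat.ble_eq,
      Nat.shiftRight_eq_div_pow] at h
    simpa [pow_mul] using h.resolve_left (by omega)
  | succ j ih =>
    intro a X h i hi hm
    rw [packedTest_succ, Bool.and_eq_true] at h
    rw [pow_succ] at hi
    by_cases hij : i < 2 ^ j
    · have := ih h.1 i hij hm
      rw [Nat.and_two_pow_sub_one_eq_mod, pow_mul] at this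
      have key : ∀ k ≤ 3, X % (2 ^ w) ^ (2 ^ j + 3) / (2 ^ w) ^ (i + k) % 2 ^ w =
          X / (2 ^ w) ^ (i + k) % 2 ^ w := by
        intro k hk
        obtain ⟨t, ht⟩ := Nat.exists_eq_add_of_lt (show i + k < 2 ^ j + 3 by omega)
        rw [ht, add_assoc (i + k), pow_add, Nat.mod_mul_right_div_self, pow_succ',
          Nat.mod_mul_right_mod]
      have k0 := key 0 (by omega)
      rw [add_zero] at k0
      rwa [k0, key 1 (by omega), key 2 (by omega), key 3 (by omega)] at this
    · obtain ⟨t, rfl⟩ := Nat.exists_eq_add_of_le (not_lt.1 hij)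
      have := ih h.2 t (by omega) (by omega)
      rw [Nat.shiftRight_eq_div_pow, pow_mul] at this
      simpa only [Nat.div_div_eq_div_mul, ← pow_add, ← add_assoc] using this

theorem eq_of_mul_mod_eq_one {T E X P : ℕ} (hX : X < T) (hP : P < T) (h1 : E * X % T = 1)
    (h2 : (T : ℤ) ∣ P * E - 1) : X = P := by
  have h3 : ((E : ℤ) * X) ≡ 1 [ZMOD T] := by
    rw [Int.ModEq]
    have hT : 1 < T := by
      have := Nat.mod_lt (E * X) (by omega : T > 0)
      rw [h1] at this; exact this
    rw [Int.emod_eq_of_lt zero_le_one (by exact_mod_cast hT)]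
    exact_mod_cast h1
  have h4 : ((P : ℤ) * E) ≡ 1 [ZMOD T] := ((Int.modEq_iff_dvd).2 h2).symm
  have h5 : (X : ℤ) ≡ P [ZMOD T] := by
    calc (X : ℤ) = 1 * X := (one_mul _).symm
      _ ≡ P * E * X [ZMOD T] := h4.symm.mul_right _
      _ = P * (E * X) := by ring
      _ ≡ P * 1 [ZMOD T] := h3.mul_left _
      _ = P := mul_one _
  exact Nat.ModEq.eq_of_lt_of_lt (Int.natCast_modEq_iff.1 h5) hX hP

theorem turanTest_of_packedCheck {w m i j a : ℕ} (h : packedCheck w m i j a = true)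
    (hw : m ≤ w + 1) (hw0 : 0 < w) (hm : m ≤ i * (6 * i + 1)) {k : ℕ} (hk : k < 2 ^ j)
    (hkm : a + k + 3 < m) : turanTest (partitionFn (a + k)) (partitionFn (a + k + 1))
      (partitionFn (a + k + 2)) (partitionFn (a + k + 3)) = true := by
  simp only [packedCheck, forceNat_eq, Nat.and_two_pow_sub_one_eq_mod, Bool.and_eq_true,
    Nat.beq_eq] at h
  have hlt : ∀ l < m, partitionFn l < 2 ^ w := fun l hl ↦
    (partitionFn_lt (by omega : l ≤ w)).resolve_right hw0.ne'
  have hd := pow_dvd_sum_partitionFn_mul_sub_one (K := 2 * i) (M := m)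
    (by rw [Nat.le_div_iff_mul_le two_pos]; nlinarith) (2 ^ w)
  rw [← cast_packedPentagonal hw0] at hd
  have hX := eq_of_mul_mod_eq_one (T := 2 ^ (w * m)) (P := ∑ i ∈ range m,
    partitionFn i * (2 ^ w) ^ i) (Nat.mod_lt _ (by positivity))
    (by rw [pow_mul]; exact sum_mul_pow_lt m hlt) h.1
    (by push_cast; rw [pow_mul]; exact hd)
  have ht := packedTest_sound j h.2 k hk hkm
  rw [hX, Nat.shiftRight_eq_div_pow, pow_mul] at ht
  simp only [Nat.div_div_eq_div_mul, ← pow_add] at ht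
  rwa [sum_mul_pow_div_mod hlt (by omega), sum_mul_pow_div_mod hlt (by omega),
    sum_mul_pow_div_mod hlt (by omega), sum_mul_pow_div_mod hlt (by omega)] at ht

theorem turan_dP_of_turanTest {n : ℕ} (hn : 1 ≤ n)
    (h : turanTest (partitionFn (n - 1)) (partitionFn n) (partitionFn (n + 1))
      (partitionFn (n + 2)) = true) : (dP n) ^ 2 > dP (n - 1) * dP (n + 1) := by
  rw [turanTest, Nat.blt_eq] at h
  rw [dP, dP, dP, Nat.sub_add_cancel hn]
  zify at h
  linarith

set_option maxRecDepth 100000 in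
theorem packedCheck_eq_true : packedCheck 4081 4082 26 12 70 = true := by
  decide +kernel

theorem turan_dP_of_lt {n : ℕ} (hn : 71 ≤ n) (h : n < 4080) :
    (dP n) ^ 2 > dP (n - 1) * dP (n + 1) := by
  have h1 := turanTest_of_packedCheck packedCheck_eq_true (by norm_num) (by norm_num)
    (by norm_num) (k := n - 71) (by omega) (by omega)
  refine turan_dP_of_turanTest (by omega) ?_
  rwa [show 70 + (n - 71) = n - 1 by omega, show n - 1 + 1 = n by omega,
    show n - 1 + 2 = n + 1 by omega, show n - 1 + 3 = n + 2 by omega] at h1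

end Computation

section Sums

theorem hasSum_sq_mul_pow {x : ℝ} (hx : ‖x‖ < 1) :
    HasSum (fun n : ℕ ↦ (n : ℝ) ^ 2 * x ^ n) (x * (1 + x) / (1 - x) ^ 3) := by
  have h0 := hasSum_choose_mul_geometric_of_norm_lt_one 0 hx
  have h1 := hasSum_choose_mul_geometric_of_norm_lt_one 1 hx
  have h2 := hasSum_choose_mul_geometric_of_norm_lt_one 2 hx
  have hx1 : 1 - x ≠ 0 := by
    have := (abs_lt.1 hx).2
    linarith
  have h := ((h2.mul_left 2).sub (h1.mul_left 3)).add h0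
  convert! h using 1
  · funext n
    simp only [Nat.cast_choose_two, Nat.choose_one_right, Nat.choose_zero_right]
    push_cast
    ring
  · field_simp
    ring

theorem hasSum_cube_mul_pow {x : ℝ} (hx : ‖x‖ < 1) :
    HasSum (fun n : ℕ ↦ (n : ℝ) ^ 3 * x ^ n) (x * (1 + 4 * x + x ^ 2) / (1 - x) ^ 4) := by
  have h0 := hasSum_choose_mul_geometric_of_norm_lt_one 0 hx
  have h1 := hasSum_choose_mul_geometric_of_norm_lt_one 1 hx
  have h2 := hasSum_choose_mul_geometric_of_norm_lt_one 2 hx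
  have h3 := hasSum_choose_mul_geometric_of_norm_lt_one 3 hx
  have hx1 : 1 - x ≠ 0 := by
    have := (abs_lt.1 hx).2
    linarith
  have h := (((h3.mul_left 6).sub (h2.mul_left 12)).add (h1.mul_left 7)).sub h0
  have hc (n : ℕ) : 6 * ((n + 3).choose 3 : ℝ) = (n + 1) * (n + 2) * (n + 3) := by
    have := Nat.descFactorial_eq_factorial_mul_choose (n + 3) 3
    simp only [Nat.descFactorial, Nat.factorial] at this
    rw [show n + 3 - 2 = n + 1 by omega, show n + 3 - 1 = n + 2 by omega] at this
    have h := congrArg (Nat.cast (R := ℝ)) this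
    push_cast at h
    linarith
  convert! h using 1
  · funext n
    simp only [Nat.cast_choose_two, Nat.choose_one_right, Nat.choose_zero_right]
    rw [← mul_assoc 6, hc]
    push_cast
    ring
  · field_simp
    ring

theorem le_cosh (u : ℝ) : 1 + u ^ 2 / 2 + u ^ 4 / 24 + u ^ 6 / 720 ≤ cosh u := by
  have h := sum_le_hasSum (range 4) (fun i _ ↦ ?_) (Real.hasSum_cosh u)
  · simpa [sum_range_succ, Nat.factorial] using h
  · rw [pow_mul]; positivity

theorem exp_neg_lt_one {u : ℝ} (hu : 0 < u) : exp (-u) < 1 := by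
  rw [exp_lt_one_iff]
  linarith

theorem norm_exp_neg_lt_one {u : ℝ} (hu : 0 < u) : ‖exp (-u)‖ < 1 := by
  rw [norm_of_nonneg (exp_nonneg _), exp_lt_one_iff]
  linarith

/-- `sinh (u / 2) ^ 2`, in terms of `exp (-u)`. -/
theorem exists_one_sub_sq {u : ℝ} (hu : 0 < u) : ∃ a b : ℝ, 0 < a ∧ 0 < b ∧ u ^ 2 = 4 * b ∧
    (1 - exp (-u)) ^ 2 = 4 * a * exp (-u) ∧ b + b ^ 2 / 3 + 2 * b ^ 3 / 45 ≤ a := by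
  have h := le_cosh u
  have h1 : exp u * exp (-u) = 1 := by rw [← exp_add]; simp
  have hp := exp_pos (-u)
  rw [cosh_eq] at h
  refine ⟨(exp u + exp (-u) - 2) / 4, u ^ 2 / 4, ?_, by positivity, by ring, ?_, ?_⟩
  · have : 0 < u ^ 2 / 2 + u ^ 4 / 24 + u ^ 6 / 720 := by positivity
    linarith
  · linear_combination -h1
  · nlinarith

theorem sum_mul_exp_le {u : ℝ} (hu : 0 < u) :
    HasSum (fun n : ℕ ↦ (n : ℝ) * exp (-u) ^ n) (exp (-u) / (1 - exp (-u)) ^ 2) ∧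
      exp (-u) / (1 - exp (-u)) ^ 2 ≤ 1 / u ^ 2 := by
  refine ⟨hasSum_coe_mul_geometric_of_norm_lt_one (norm_exp_neg_lt_one hu), ?_⟩
  obtain ⟨a, b, ha, hb, h1, h2, h3⟩ := exists_one_sub_sq hu
  have hx := exp_pos (-u)
  rw [h1, h2, div_le_div_iff₀ (by positivity) (by positivity)]
  have : b ≤ a := by
    have : 0 ≤ b ^ 2 / 3 + 2 * b ^ 3 / 45 := by positivity
    linarith
  nlinarith

theorem sum_sq_mul_exp_le {u : ℝ} (hu : 0 < u) :
    HasSum (fun n : ℕ ↦ (n : ℝ) ^ 2 * exp (-u) ^ n)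
      (exp (-u) * (1 + exp (-u)) / (1 - exp (-u)) ^ 3) ∧
      exp (-u) * (1 + exp (-u)) / (1 - exp (-u)) ^ 3 ≤ 2 / u ^ 3 := by
  refine ⟨hasSum_sq_mul_pow (norm_exp_neg_lt_one hu), ?_⟩
  obtain ⟨a, b, ha, hb, h1, h2, h3⟩ := exists_one_sub_sq hu
  have hx := exp_pos (-u)
  set x := exp (-u)
  have hx1 : 0 < 1 - x := by
    have := (abs_lt.1 (norm_exp_neg_lt_one hu)).2
    linarith
  refine le_of_sq_le_sq ?_ (by positivity)
  have e1 : (x * (1 + x) / (1 - x) ^ 3) ^ 2 = (1 + a) / (16 * a ^ 3) := by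
    have : (1 + x) ^ 2 = 4 * x * (1 + a) := by linear_combination h2
    calc (x * (1 + x) / (1 - x) ^ 3) ^ 2 = x ^ 2 * (1 + x) ^ 2 / ((1 - x) ^ 2) ^ 3 := by
          rw [div_pow, mul_pow, ← pow_mul, ← pow_mul]
      _ = _ := by rw [this, h2]; field_simp; ring
  have e2 : (2 / u ^ 3) ^ 2 = 1 / (16 * b ^ 3) := by
    calc (2 / u ^ 3) ^ 2 = 4 / (u ^ 2) ^ 3 := by ring
      _ = _ := by rw [h1]; field_simp; ring
  rw [e1, e2, div_le_div_iff₀ (by positivity) (by positivity)]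
  set c := b + b ^ 2 / 3 + 2 * b ^ 3 / 45 with hc
  have hc0 : 0 < c := by positivity
  have e3 : b ^ 3 * c + b ^ 3 ≤ c ^ 3 := by
    have : c ^ 3 - (b ^ 3 * c + b ^ 3) = b ^ 5 * (2 / 15 + 11 / 135 * b + b ^ 2 * (14 / 675) +
      b ^ 3 * (4 / 2025) + b ^ 4 * (8 / 91125)) := by rw [hc]; ring
    have : 0 ≤ b ^ 5 * (2 / 15 + 11 / 135 * b + b ^ 2 * (14 / 675) +
      b ^ 3 * (4 / 2025) + b ^ 4 * (8 / 91125)) := by positivity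
    linarith
  have e4 : b ^ 3 ≤ c ^ 2 + c * a + a ^ 2 := by
    have : c ^ 2 = b ^ 2 + 2 / 3 * b ^ 3 + b ^ 4 / 5 + 4 / 135 * b ^ 5 + 4 / 2025 * b ^ 6 := by
      rw [hc]; ring
    have : 0 ≤ b ^ 2 + b ^ 4 / 5 + 4 / 135 * b ^ 5 + 4 / 2025 * b ^ 6 := by positivity
    have : c ^ 2 ≤ c * a := by nlinarith
    have : 0 ≤ a ^ 2 := by positivity
    have : 0 ≤ b ^ 3 := by positivity
    linarith
  have e5 : 0 ≤ (a - c) * (c ^ 2 + c * a + a ^ 2 - b ^ 3) :=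
    mul_nonneg (by linarith) (by linarith)
  linarith

theorem sum_cube_mul_exp_le {u : ℝ} (hu : 0 < u) :
    HasSum (fun n : ℕ ↦ (n : ℝ) ^ 3 * exp (-u) ^ n)
      (exp (-u) * (1 + 4 * exp (-u) + exp (-u) ^ 2) / (1 - exp (-u)) ^ 4) ∧
      exp (-u) * (1 + 4 * exp (-u) + exp (-u) ^ 2) / (1 - exp (-u)) ^ 4 ≤ 7 / u ^ 4 := by
  refine ⟨hasSum_cube_mul_pow (norm_exp_neg_lt_one hu), ?_⟩
  obtain ⟨a, b, ha, hb, h1, h2, h3⟩ := exists_one_sub_sq hu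
  have hx := exp_pos (-u)
  set x := exp (-u)
  have e1 : x * (1 + 4 * x + x ^ 2) / (1 - x) ^ 4 = (4 * a + 6) / (16 * a ^ 2) := by
    have : 1 + 4 * x + x ^ 2 = x * (4 * a + 6) := by linear_combination h2
    calc x * (1 + 4 * x + x ^ 2) / (1 - x) ^ 4 =
          x * (1 + 4 * x + x ^ 2) / ((1 - x) ^ 2) ^ 2 := by ring
      _ = _ := by rw [this, h2]; field_simp; ring
  have e2 : 7 / u ^ 4 = 7 / (16 * b ^ 2) := by
    calc 7 / u ^ 4 = 7 / (u ^ 2) ^ 2 := by ring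
      _ = _ := by rw [h1]; ring
  rw [e1, e2, div_le_div_iff₀ (by positivity) (by positivity)]
  set c := b + b ^ 2 / 3 + 2 * b ^ 3 / 45 with hc
  have e3 : 4 * b ^ 2 * c + 6 * b ^ 2 ≤ 7 * c ^ 2 := by
    have : 7 * c ^ 2 - (4 * b ^ 2 * c + 6 * b ^ 2) = b ^ 2 * (1 + 2 / 3 * b + b ^ 2 / 15 +
      b ^ 3 * (4 / 135) + b ^ 4 * (28 / 2025)) := by rw [hc]; ring
    have : 0 ≤ b ^ 2 * (1 + 2 / 3 * b + b ^ 2 / 15 +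
      b ^ 3 * (4 / 135) + b ^ 4 * (28 / 2025)) := by positivity
    linarith
  have e4 : 4 * b ^ 2 ≤ 7 * (a + c) := by
    have : 0 ≤ 14 * b + 2 / 3 * b ^ 2 + 28 * b ^ 3 / 45 := by positivity
    linarith
  have e5 : 0 ≤ (a - c) * (7 * (a + c) - 4 * b ^ 2) :=
    mul_nonneg (by linarith) (by linarith)
  linarith

end Sums

section Exponents

/-- The frequency `m * k` of the term `(m, k)` of the logarithm of the generating function, where
`1 ≤ m` and `2 ≤ k`. -/
def freq (p : ℕ × ℕ) : ℝ := (p.1 + 1) * (p.2 + 2)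

/-- The weight `exp (-s * m * k) / m` of the term `(m, k)`. -/
noncomputable def weight (s : ℝ) (p : ℕ × ℕ) : ℝ := exp (-(s * freq p)) / (p.1 + 1)

theorem one_le_freq (p : ℕ × ℕ) : 1 ≤ freq p := by
  have h1 : (0 : ℝ) ≤ p.1 := p.1.cast_nonneg
  have h2 : (0 : ℝ) ≤ p.2 := p.2.cast_nonneg
  rw [freq]
  nlinarith

theorem freq_nonneg (p : ℕ × ℕ) : 0 ≤ freq p := zero_le_one.trans (one_le_freq p)

theorem weight_nonneg (s : ℝ) (p : ℕ × ℕ) : 0 ≤ weight s p := by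
  rw [weight]; positivity

theorem weight_mul_freq_pow (s : ℝ) (i : ℕ) (m k : ℕ) : weight s (m, k) * freq (m, k) ^ (i + 1) =
    ((m : ℝ) + 1) ^ i *
      (((k + 2 : ℕ) : ℝ) ^ (i + 1) * exp (-(((m : ℝ) + 1) * s)) ^ (k + 2)) := by
  rw [weight, ← exp_nat_mul, freq]
  push_cast
  rw [show ((k : ℝ) + 2) * -((m + 1) * s) = -(s * ((m + 1) * (k + 2))) by ring,
    mul_pow]
  field_simp
  ring

/-- A bound for the moments of the weights, from a bound for the sums of `n ^ (i + 1) * x ^ n`. -/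
theorem sum_weight_mul_freq_pow {C s : ℝ} {i : ℕ} {v : ℝ → ℝ}
    (hv : ∀ u : ℝ, 0 < u → HasSum (fun n : ℕ ↦ (n : ℝ) ^ (i + 1) * exp (-u) ^ n) (v u) ∧
      v u ≤ C / u ^ (i + 2)) (hs : 0 < s) :
    Summable (fun p ↦ weight s p * freq p ^ (i + 1)) ∧
      ∑' p, weight s p * freq p ^ (i + 1) ≤ C / s ^ (i + 2) * (π ^ 2 / 6) := by
  have hu (m : ℕ) : 0 < ((m : ℝ) + 1) * s := by positivity
  have hz : HasSum (fun m : ℕ ↦ C / s ^ (i + 2) * (1 / ((m : ℝ) + 1) ^ 2))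
      (C / s ^ (i + 2) * (π ^ 2 / 6)) := by
    refine HasSum.mul_left _ ?_
    have := (hasSum_nat_add_iff' 1).2 hasSum_zeta_two
    simpa using this
  have hfib (m : ℕ) : Summable (fun k ↦ weight s (m, k) * freq (m, k) ^ (i + 1)) := by
    simp_rw [weight_mul_freq_pow]
    exact (((hv _ (hu m)).1.summable.comp_injective (add_left_injective 2))).mul_left _
  have hle (m : ℕ) : ∑' k, weight s (m, k) * freq (m, k) ^ (i + 1) ≤
      C / s ^ (i + 2) * (1 / ((m : ℝ) + 1) ^ 2) := by
    simp_rw [weight_mul_freq_pow]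
    rw [tsum_mul_left]
    have h1 := tsum_comp_le_tsum_of_inj (hv _ (hu m)).1.summable (fun n ↦ by positivity)
      (add_left_injective 2)
    rw [(hv _ (hu m)).1.tsum_eq] at h1
    calc _ ≤ ((m : ℝ) + 1) ^ i * (C / (((m : ℝ) + 1) * s) ^ (i + 2)) := by
          refine mul_le_mul_of_nonneg_left (h1.trans (hv _ (hu m)).2) (by positivity)
      _ = _ := by
          rw [mul_pow, pow_add _ i 2]
          field_simp
  have hnn (m : ℕ) : 0 ≤ ∑' k, weight s (m, k) * freq (m, k) ^ (i + 1) :=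
    tsum_nonneg fun k ↦ mul_nonneg (weight_nonneg _ _) (pow_nonneg (freq_nonneg _) _)
  have hsum : Summable (fun p ↦ weight s p * freq p ^ (i + 1)) :=
    (summable_prod_of_nonneg fun p ↦
      mul_nonneg (weight_nonneg _ _) (pow_nonneg (freq_nonneg _) _)).2
        ⟨hfib, Summable.of_nonneg_of_le hnn hle hz.summable⟩
  refine ⟨hsum, ?_⟩
  rw [hsum.tsum_prod, ← hz.tsum_eq]
  exact (Summable.of_nonneg_of_le hnn hle hz.summable).tsum_le_tsum hle hz.summable

theorem sum_weight_mul_freq {s : ℝ} (hs : 0 < s) : Summable (fun p ↦ weight s p * freq p) ∧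
    ∑' p, weight s p * freq p ≤ 1 / s ^ 2 * (π ^ 2 / 6) := by
  simpa using sum_weight_mul_freq_pow (i := 0) (C := 1)
    (v := fun u ↦ exp (-u) / (1 - exp (-u)) ^ 2) (fun u hu ↦ by simpa using sum_mul_exp_le hu) hs

theorem sum_weight_mul_freq_sq {s : ℝ} (hs : 0 < s) :
    Summable (fun p ↦ weight s p * freq p ^ 2) ∧
      ∑' p, weight s p * freq p ^ 2 ≤ 2 / s ^ 3 * (π ^ 2 / 6) :=
  sum_weight_mul_freq_pow (i := 1) (fun _ hu ↦ sum_sq_mul_exp_le hu) hs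

theorem sum_weight_mul_freq_cube {s : ℝ} (hs : 0 < s) :
    Summable (fun p ↦ weight s p * freq p ^ 3) ∧
      ∑' p, weight s p * freq p ^ 3 ≤ 7 / s ^ 4 * (π ^ 2 / 6) :=
  sum_weight_mul_freq_pow (i := 2) (fun _ hu ↦ sum_cube_mul_exp_le hu) hs

theorem summable_weight {s : ℝ} (hs : 0 < s) : Summable (weight s) :=
  (sum_weight_mul_freq hs).1.of_nonneg_of_le (weight_nonneg s)
    fun p ↦ le_mul_of_one_le_right (weight_nonneg s p) (one_le_freq p)

/-- The logarithm of the modulus of the generating function on a circle, negated and normalized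
to vanish at the angle `0`. -/
noncomputable def decay (s θ : ℝ) : ℝ := ∑' p, weight s p * (1 - cos (freq p * θ))

/-- The argument of the generating function on a circle. -/
noncomputable def phase (s θ : ℝ) : ℝ := ∑' p, weight s p * sin (freq p * θ)

theorem summable_decay {s : ℝ} (hs : 0 < s) (θ : ℝ) :
    Summable fun p ↦ weight s p * (1 - cos (freq p * θ)) :=
  ((summable_weight hs).mul_right 2).of_nonneg_of_le
    (fun p ↦ mul_nonneg (weight_nonneg _ _) (sub_nonneg.2 (cos_le_one _)))
    fun p ↦ mul_le_mul_of_nonneg_left (by linarith [neg_one_le_cos (freq p * θ)])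
      (weight_nonneg _ _)

theorem norm_weight_mul_sin_le (s θ : ℝ) (p : ℕ × ℕ) :
    ‖weight s p * sin (freq p * θ)‖ ≤ weight s p := by
  rw [norm_mul, norm_of_nonneg (weight_nonneg _ _)]
  exact mul_le_of_le_one_right (weight_nonneg _ _) (abs_sin_le_one _)

theorem summable_phase {s : ℝ} (hs : 0 < s) (θ : ℝ) :
    Summable fun p ↦ weight s p * sin (freq p * θ) :=
  (summable_weight hs).of_norm_bounded (norm_weight_mul_sin_le s θ)

theorem continuous_decay {s : ℝ} (hs : 0 < s) : Continuous (decay s) := by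
  refine continuous_tsum (fun p ↦ by fun_prop) ((summable_weight hs).mul_right 2) fun p θ ↦ ?_
  rw [norm_of_nonneg (mul_nonneg (weight_nonneg _ _) (sub_nonneg.2 (cos_le_one _)))]
  exact mul_le_mul_of_nonneg_left (by linarith [neg_one_le_cos (freq p * θ)]) (weight_nonneg _ _)

theorem continuous_phase {s : ℝ} (hs : 0 < s) : Continuous (phase s) :=
  continuous_tsum (fun p ↦ by fun_prop) (summable_weight hs)
    fun p θ ↦ norm_weight_mul_sin_le s θ p

theorem decay_le {s : ℝ} (hs : 0 < s) (θ : ℝ) : decay s θ ≤ π ^ 2 / 6 / s ^ 3 * θ ^ 2 := by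
  have h := sum_weight_mul_freq_sq hs
  calc decay s θ ≤ ∑' p, weight s p * freq p ^ 2 * (θ ^ 2 / 2) := by
        refine (summable_decay hs θ).tsum_le_tsum (fun p ↦ ?_) (h.1.mul_right _)
        rw [mul_assoc]
        refine mul_le_mul_of_nonneg_left ?_ (weight_nonneg _ _)
        have := one_sub_sq_div_two_le_cos (x := freq p * θ)
        rw [mul_pow] at this
        linarith
    _ = (∑' p, weight s p * freq p ^ 2) * (θ ^ 2 / 2) := tsum_mul_right
    _ ≤ 2 / s ^ 3 * (π ^ 2 / 6) * (θ ^ 2 / 2) := by gcongr; exact h.2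
    _ = _ := by ring

theorem abs_phase_sub_le {s : ℝ} (hs : 0 < s) {θ : ℝ} (hθ : 0 ≤ θ) :
    |phase s θ - (∑' p, weight s p * freq p) * θ| ≤ 7 / s ^ 4 * (π ^ 2 / 6) * (θ ^ 3 / 6) := by
  have h1 := sum_weight_mul_freq hs
  have h3 := sum_weight_mul_freq_cube hs
  have e : (∑' p, weight s p * freq p) * θ - phase s θ =
      ∑' p, (weight s p * freq p * θ - weight s p * sin (freq p * θ)) := by
    rw [(h1.1.mul_right θ).tsum_sub (summable_phase hs θ), tsum_mul_right, phase]
  have hb (p : ℕ × ℕ) : 0 ≤ weight s p * freq p * θ - weight s p * sin (freq p * θ) ∧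
      weight s p * freq p * θ - weight s p * sin (freq p * θ) ≤
        weight s p * freq p ^ 3 * (θ ^ 3 / 6) := by
    have hx : 0 ≤ freq p * θ := mul_nonneg (freq_nonneg p) hθ
    have e1 := mul_le_mul_of_nonneg_left (sin_le hx) (weight_nonneg s p)
    have e2 := mul_le_mul_of_nonneg_left (sin_ge_sub_cube hx) (weight_nonneg s p)
    constructor <;> linarith
  rw [abs_sub_comm, e, abs_of_nonneg (tsum_nonneg fun p ↦ (hb p).1)]
  calc _ ≤ ∑' p, weight s p * freq p ^ 3 * (θ ^ 3 / 6) :=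
        ((h1.1.mul_right θ).sub (summable_phase hs θ)).tsum_le_tsum (fun p ↦ (hb p).2)
          (h3.1.mul_right _)
    _ = (∑' p, weight s p * freq p ^ 3) * (θ ^ 3 / 6) := tsum_mul_right
    _ ≤ _ := by gcongr; exact h3.2

theorem pi_sq_div_six_lt : π ^ 2 / 6 < 1.645 := by
  have := pi_lt_d6
  have := pi_pos
  nlinarith

/-- The saddle point equation has a solution close to zero. -/
theorem exists_sum_weight_mul_freq_eq {N : ℝ} (hN : 3950 ≤ N) :
    ∃ s : ℝ, 0 < s ∧ s ≤ 1 / 49 ∧ ∑' p, weight s p * freq p = N := by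
  set δ := 1 / (8 * N) with hδ
  have hδ0 : 0 < δ := by positivity
  have hδ1 : δ ≤ 1 / 49 := one_div_le_one_div_of_le (by norm_num) (by linarith)
  have hc : ContinuousOn (fun s ↦ ∑' p, weight s p * freq p) (Set.Icc δ (1 / 49)) := by
    refine continuousOn_tsum (u := fun p ↦ weight δ p * freq p) (fun p ↦ ?_)
      (sum_weight_mul_freq hδ0).1 fun p s hs ↦ ?_
    · unfold weight
      fun_prop
    · rw [norm_of_nonneg (mul_nonneg (weight_nonneg _ _) (freq_nonneg _))]
      refine mul_le_mul_of_nonneg_right ?_ (freq_nonneg p)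
      unfold weight
      have := freq_nonneg p
      gcongr
      exact hs.1
  have h1 : (fun s ↦ ∑' p, weight s p * freq p) (1 / 49) ≤ N := by
    refine (sum_weight_mul_freq (by norm_num)).2.trans ?_
    linarith [pi_sq_div_six_lt]
  have h2 : N ≤ (fun s ↦ ∑' p, weight s p * freq p) δ := by
    set M := ⌈N⌉₊ with hM
    have hMN : N ≤ M := Nat.le_ceil N
    have hMN2 : (M : ℝ) < N + 1 := Nat.ceil_lt_add_one (by linarith)
    have hterm : ∀ m ∈ range M, 1 ≤ weight δ (m, 0) * freq (m, 0) := by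
      intro m hm
      have hm1 : (m : ℝ) + 1 ≤ M := by exact_mod_cast mem_range.1 hm
      have e : weight δ (m, 0) * freq (m, 0) = 2 * exp (-(δ * ((m + 1) * 2))) := by
        rw [weight, freq]
        push_cast
        field_simp
        simp
      rw [e]
      have : δ * ((m + 1) * 2) ≤ 1 / 2 := by
        rw [hδ, div_mul_eq_mul_div, div_le_div_iff₀ (by linarith) two_pos]
        linarith
      linarith [add_one_le_exp (-(δ * (((m : ℝ) + 1) * 2)))]
    calc N ≤ ∑ m ∈ range M, (1 : ℝ) := by simpa using hMN
      _ ≤ ∑ m ∈ range M, weight δ (m, 0) * freq (m, 0) := sum_le_sum hterm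
      _ = ∑ p ∈ (range M).map ⟨fun m ↦ (m, 0), fun _ _ h ↦ (Prod.ext_iff.1 h).1⟩,
          weight δ p * freq p := by rw [sum_map]; rfl
      _ ≤ _ := (sum_weight_mul_freq hδ0).1.sum_le_tsum _
          fun p _ ↦ mul_nonneg (weight_nonneg _ _) (freq_nonneg _)
  obtain ⟨s, hs, he⟩ := intermediate_value_Icc' hδ1 hc ⟨h1, h2⟩
  exact ⟨s, hδ0.trans_le hs.1, hs.2, he⟩

end Exponents

section DecayBounds

/-- The sum over `k ≥ 2` of `exp (-u * k) * (1 - cos (k * α))`. -/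
noncomputable def decayTerm (u α : ℝ) : ℝ :=
  (1 + exp (-u)) / (2 * (1 - exp (-u))) *
    (2 * exp (-u) * (1 - cos α) / ((1 - exp (-u)) ^ 2 + 2 * exp (-u) * (1 - cos α))) -
      exp (-u) * (1 - cos α)

theorem hasSum_pow_mul_cos {x : ℝ} (hx0 : 0 < x) (hx1 : x < 1) (α : ℝ) :
    HasSum (fun k : ℕ ↦ x ^ k * cos (k * α))
      ((1 - x * cos α) / ((1 - x) ^ 2 + 2 * x * (1 - cos α))) := by
  have hn : ‖(x : ℂ) * Complex.exp (α * Complex.I)‖ < 1 := by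
    rwa [norm_mul, Complex.norm_exp_ofReal_mul_I, mul_one, Complex.norm_real,
      norm_of_nonneg hx0.le]
  have h := Complex.hasSum_re (hasSum_geometric_of_norm_lt_one hn)
  convert! h using 1
  · funext k
    rw [mul_pow, ← Complex.exp_nat_mul, ← mul_assoc, ← Complex.ofReal_natCast,
      ← Complex.ofReal_mul, ← Complex.ofReal_pow, Complex.re_ofReal_mul,
      Complex.exp_ofReal_mul_I_re]
  · rw [Complex.inv_re, Complex.normSq_apply]
    simp only [Complex.sub_re, Complex.one_re, Complex.re_ofReal_mul, Complex.sub_im,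
      Complex.one_im, Complex.im_ofReal_mul, Complex.exp_ofReal_mul_I_re,
      Complex.exp_ofReal_mul_I_im]
    congr 1
    linear_combination (-x ^ 2) * sin_sq_add_cos_sq α

theorem hasSum_decayTerm {u : ℝ} (hu : 0 < u) (α : ℝ) :
    HasSum (fun k : ℕ ↦ exp (-u) ^ (k + 2) * (1 - cos ((k + 2 : ℕ) * α))) (decayTerm u α) := by
  have hx0 := exp_pos (-u)
  have hx1 := exp_neg_lt_one hu
  have h := (hasSum_geometric_of_lt_one hx0.le hx1).sub (hasSum_pow_mul_cos hx0 hx1 α)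
  have h2 := (hasSum_nat_add_iff' 2).2 h
  have hc := cos_le_one α
  convert! h2 using 1
  · funext k
    ring
  · rw [decayTerm]
    set x := exp (-u)
    have e1 : 0 < 1 - x := by linarith
    have e2 : 0 < (1 - x) ^ 2 + 2 * x * (1 - cos α) := by
      have := mul_nonneg (mul_nonneg two_pos.le hx0.le) (sub_nonneg.2 hc)
      positivity
    simp only [sum_range_succ, range_zero, sum_empty, pow_zero, Nat.cast_zero, zero_mul, cos_zero,
      pow_one, Nat.cast_one, one_mul]
    generalize hD : (1 - x) ^ 2 + 2 * x * (1 - cos α) = D at e2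
    field_simp
    linear_combination hD

theorem weight_mul_one_sub_cos (s θ : ℝ) (m k : ℕ) :
    weight s (m, k) * (1 - cos (freq (m, k) * θ)) = (1 / ((m : ℝ) + 1)) *
      (exp (-(((m : ℝ) + 1) * s)) ^ (k + 2) * (1 - cos ((k + 2 : ℕ) * (((m : ℝ) + 1) * θ)))) := by
  rw [weight, ← exp_nat_mul, freq]
  push_cast
  rw [show ((k : ℝ) + 2) * -((m + 1) * s) = -(s * ((m + 1) * (k + 2))) by ring,
    show ((k : ℝ) + 2) * ((m + 1) * θ) = (m + 1) * (k + 2) * θ by ring]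
  ring

theorem hasSum_fiber_decay {s : ℝ} (hs : 0 < s) (θ : ℝ) (m : ℕ) :
    HasSum (fun k ↦ weight s (m, k) * (1 - cos (freq (m, k) * θ)))
      (1 / ((m : ℝ) + 1) * decayTerm ((m + 1) * s) ((m + 1) * θ)) := by
  simp_rw [weight_mul_one_sub_cos]
  exact (hasSum_decayTerm (by positivity) _).mul_left _

theorem decayTerm_nonneg {u : ℝ} (hu : 0 < u) (α : ℝ) : 0 ≤ decayTerm u α :=
  (hasSum_decayTerm hu α).nonneg fun _ ↦
    mul_nonneg (pow_nonneg (exp_nonneg _) _) (sub_nonneg.2 (cos_le_one _))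

theorem decayTerm_add_le {s : ℝ} (hs : 0 < s) (θ : ℝ) :
    decayTerm s θ + decayTerm (2 * s) (2 * θ) / 2 ≤ decay s θ := by
  have h : HasSum (fun m : ℕ ↦ 1 / ((m : ℝ) + 1) * decayTerm ((m + 1) * s) ((m + 1) * θ))
      (decay s θ) := (summable_decay hs θ).hasSum.prod_fiberwise (hasSum_fiber_decay hs θ)
  have h2 := sum_le_hasSum (range 2) (fun m _ ↦ mul_nonneg (by positivity)
    (decayTerm_nonneg (by positivity) _)) h
  simp only [sum_range_succ, range_zero, sum_empty] at h2
  norm_num at h2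
  linarith

theorem le_decayTerm {u α : ℝ} (hu : 0 < u) {w : ℝ} (hw : 0 ≤ w)
    (hu1 : u ≤ 2 / 49) (h : w * ((1 - exp (-u)) ^ 2 + 2 * exp (-u) * (1 - cos α)) ≤
      2 * exp (-u) * (1 - cos α)) :
    0.979 / u * w - (1 - cos α) ≤ decayTerm u α := by
  have hx0 := exp_pos (-u)
  have hx1 := exp_neg_lt_one hu
  have hx2 := add_one_le_exp (-u)
  have hc := cos_le_one α
  rw [decayTerm]
  set x := exp (-u)
  have e1 : 0 < 1 - x := by linarith
  have e2 : 0 < (1 - x) ^ 2 + 2 * x * (1 - cos α) := by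
    have := mul_nonneg (mul_nonneg two_pos.le hx0.le) (sub_nonneg.2 hc)
    positivity
  have e3 : 0.979 / u ≤ (1 + x) / (2 * (1 - x)) := by
    rw [div_le_div_iff₀ hu (by positivity)]
    nlinarith
  have e4 := (le_div_iff₀ e2).2 h
  have e5 : x * (1 - cos α) ≤ 1 - cos α := mul_le_of_le_one_left (by linarith) hx1.le
  have e6 := mul_le_mul e3 e4 hw (by positivity)
  linarith

theorem le_decayTerm_of_le {u α : ℝ} (hu : 0 < u) (hu1 : u ≤ 2 / 49) (hα : |α| ≤ 2 * u) :
    0.96 / u * (α ^ 2 / (u ^ 2 + α ^ 2)) ≤ decayTerm u α := by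
  have hα2 : α ^ 2 ≤ 4 * u ^ 2 := by
    rw [← sq_abs]
    nlinarith [abs_nonneg α]
  have hu2 : u ^ 2 ≤ 0.0017 := by nlinarith
  have hx0 := exp_pos (-u)
  have hy : 0.999 * α ^ 2 ≤ 2 * (1 - cos α) := by
    have h := (abs_le.1 (cos_bound (x := α) (hα.trans (by linarith)))).2
    have : |α| ^ 4 = α ^ 2 * α ^ 2 := by rw [← sq_abs]; ring
    rw [this] at h
    nlinarith [mul_nonneg (sq_nonneg α) (show 0 ≤ 0.0068 - α ^ 2 by linarith)]
  have hy2 := one_sub_sq_div_two_le_cos (x := α)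
  have hx : (1 - exp (-u)) ^ 2 ≤ 1.001 * exp (-u) * u ^ 2 := by
    have h1 := cosh_le_exp_half_sq u
    have h2 : exp (u ^ 2 / 2) ≤ 1 + u ^ 2 / 2 + (u ^ 2 / 2) ^ 2 := by
      have := (abs_le.1 (abs_exp_sub_one_sub_id_le (x := u ^ 2 / 2)
        (by rw [abs_of_nonneg (by positivity)]; nlinarith))).2
      linarith
    rw [cosh_eq] at h1
    have h3 : exp u + exp (-u) - 2 ≤ 1.001 * u ^ 2 := by
      nlinarith [mul_nonneg (sq_nonneg u) (show 0 ≤ 0.0017 - u ^ 2 by linarith)]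
    have h4 : exp u * exp (-u) = 1 := by rw [← exp_add]; simp
    have h5 := mul_le_mul_of_nonneg_right h3 hx0.le
    linarith
  have hD : 0 < u ^ 2 + α ^ 2 := by positivity
  refine le_trans ?_ (le_decayTerm hu (w := 0.998 * (α ^ 2 / (u ^ 2 + α ^ 2)))
    (by positivity) hu1 ?_)
  · have h1 : u * (u ^ 2 + α ^ 2) ≤ 0.034 := by nlinarith [mul_pos hu hu]
    have h2 : α ^ 2 / 2 ≤ 0.017 / u * (α ^ 2 / (u ^ 2 + α ^ 2)) := by
      rw [div_mul_div_comm, div_le_div_iff₀ two_pos (by positivity)]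
      nlinarith [mul_le_mul_of_nonneg_left h1 (sq_nonneg α)]
    have h3 : 0 ≤ 1 / u * (α ^ 2 / (u ^ 2 + α ^ 2)) := by positivity
    have e (c : ℝ) : c / u * (α ^ 2 / (u ^ 2 + α ^ 2)) =
      c * (1 / u * (α ^ 2 / (u ^ 2 + α ^ 2))) := by ring
    rw [e] at h2 ⊢
    have := e 0.979
    linarith
  · rw [← mul_div_assoc, div_mul_eq_mul_div, div_le_iff₀ hD]
    set x := exp (-u)
    have e1 := mul_le_mul_of_nonneg_left hx (sq_nonneg α)
    have e2 := mul_le_mul_of_nonneg_left hy (mul_nonneg hx0.le (sq_nonneg u))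
    have e3 : 0 ≤ x * (1 - cos α) * α ^ 2 := by
      have := cos_le_one α
      have : 0 ≤ 1 - cos α := by linarith
      positivity
    have e4 : 0 ≤ x * u ^ 2 * α ^ 2 := by positivity
    linarith

theorem le_decay_of_le {s θ : ℝ} (hs : 0 < s) (hs1 : s ≤ 1 / 49) (hθ : |θ| ≤ 2 * s) :
    1.2 / s * (θ ^ 2 / (s ^ 2 + θ ^ 2)) ≤ decay s θ := by
  refine le_trans ?_ (decayTerm_add_le hs θ)
  have h1 := le_decayTerm_of_le hs (by linarith) hθ
  have h2 := le_decayTerm_of_le (u := 2 * s) (α := 2 * θ) (by positivity) (by linarith)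
    (by rw [abs_mul, abs_two]; linarith)
  have e : 0.96 / (2 * s) * ((2 * θ) ^ 2 / ((2 * s) ^ 2 + (2 * θ) ^ 2)) =
      0.48 / s * (θ ^ 2 / (s ^ 2 + θ ^ 2)) := by
    have : 0 < s ^ 2 + θ ^ 2 := by positivity
    field_simp
    ring
  rw [e] at h2
  have e2 : 1.2 / s * (θ ^ 2 / (s ^ 2 + θ ^ 2)) = 0.96 / s * (θ ^ 2 / (s ^ 2 + θ ^ 2)) +
    0.48 / s * (θ ^ 2 / (s ^ 2 + θ ^ 2)) / 2 := by ring
  linarith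

theorem le_decay_of_ge {s θ : ℝ} (hs : 0 < s) (hs1 : s ≤ 1 / 49) (hθ : 2 * s ≤ θ) (hπ : θ ≤ π) :
    0.55 / s ≤ decay s θ := by
  refine le_trans ?_ ((le_add_of_nonneg_right (by
    have := decayTerm_nonneg (u := 2 * s) (by positivity) (2 * θ)
    positivity)).trans (decayTerm_add_le hs θ))
  have hx0 := exp_pos (-s)
  have hx1 := exp_neg_lt_one hs
  have hx2 := add_one_le_exp (-s)
  have hy : 1.62 * s ^ 2 ≤ 2 * (1 - cos θ) := by
    have h := cos_le_one_sub_mul_cos_sq (x := θ) (by rwa [abs_of_nonneg (by linarith)])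
    have h2 : 1.62 * s ^ 2 ≤ 4 / π ^ 2 * θ ^ 2 := by
      have := pi_sq_div_six_lt
      have : 0.405 ≤ 4 / π ^ 2 := by
        rw [le_div_iff₀ (by positivity)]
        linarith
      have : 4 * s ^ 2 ≤ θ ^ 2 := by nlinarith
      nlinarith [sq_nonneg θ]
    have e : 4 / π ^ 2 * θ ^ 2 = 2 * (2 / π ^ 2 * θ ^ 2) := by ring
    linarith
  have h := le_decayTerm hs (w := 0.6124) (α := θ) (by norm_num) (by linarith) (by
    set x := exp (-s)
    have e1 : (1 - x) ^ 2 ≤ s ^ 2 := by nlinarith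
    have e2 := mul_le_mul_of_nonneg_left hy hx0.le
    have e3 : 0.979 * s ^ 2 ≤ x * s ^ 2 := by
      refine mul_le_mul_of_nonneg_right (by linarith) (sq_nonneg _)
    linarith [sq_nonneg s])
  refine le_trans ?_ h
  have h1 : 49 ≤ 1 / s := by
    rw [le_div_iff₀ hs]
    linarith
  have e (c : ℝ) : c / s = c * (1 / s) := by ring
  rw [e, e 0.979]
  linarith [neg_one_le_cos θ]

end DecayBounds

section Positivity

open MeasureTheory

theorem integrableOn_pow_mul_exp_neg_mul_sq (k : ℕ) {b : ℝ} (hb : 0 < b) :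
    IntegrableOn (fun x : ℝ ↦ x ^ k * exp (-b * x ^ 2)) (Set.Ioi 0) := by
  have h := integrableOn_rpow_mul_exp_neg_mul_sq hb (s := k) (by
    have := k.cast_nonneg (α := ℝ)
    linarith)
  simpa only [rpow_natCast] using h

theorem integral_pow_mul_exp_neg_mul_sq (k : ℕ) {b : ℝ} (hb : 0 < b) :
    ∫ x in Set.Ioi (0 : ℝ), x ^ (2 * k) * exp (-b * x ^ 2) =
      ((2 * k - 1).doubleFactorial : ℝ) * √π / 2 ^ (k + 1) / (b ^ k * √b) := by
  have h := integral_rpow_mul_exp_neg_mul_rpow (p := (2 : ℕ)) (q := (2 * k : ℕ)) (b := b)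
    (by norm_num) (by
      have := (2 * k).cast_nonneg (α := ℝ)
      linarith) hb
  simp only [rpow_natCast] at h
  rw [h]
  have e : (((2 * k : ℕ) : ℝ) + 1) / ((2 : ℕ) : ℝ) = k + 1 / 2 := by
    push_cast; ring
  rw [neg_div, e, Gamma_nat_add_half, rpow_neg hb.le, rpow_add hb, rpow_natCast, ← sqrt_eq_rpow]
  field_simp
  push_cast
  ring

theorem integral_sq_mul_exp_neg_mul_sq {b : ℝ} (hb : 0 < b) :
    ∫ x in Set.Ioi (0 : ℝ), x ^ 2 * exp (-b * x ^ 2) = √π / 4 / (b * √b) := by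
  have h := integral_pow_mul_exp_neg_mul_sq 1 hb
  norm_num [Nat.doubleFactorial] at h
  simpa using h

theorem integral_pow_eight_mul_exp_neg_mul_sq {b : ℝ} (hb : 0 < b) :
    ∫ x in Set.Ioi (0 : ℝ), x ^ 8 * exp (-b * x ^ 2) = 105 * √π / 32 / (b ^ 4 * √b) := by
  have h := integral_pow_mul_exp_neg_mul_sq 4 hb
  norm_num [Nat.doubleFactorial] at h
  simpa using h

/-- A minorant near `θ = 0` of the integrand `exp (-decay s θ) * cos (phase s θ - N * θ) *
(1 - cos θ)`. -/
noncomputable def minorant (η a c B θ : ℝ) : ℝ :=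
  (1 - η) / 2 * (θ ^ 2 * exp (-a * θ ^ 2)) - B / 2 * (θ ^ 8 * exp (-a * θ ^ 2)) -
    B / 4 * (θ ^ 8 * exp (-c * θ ^ 2))

theorem minorant_eq (η a c B θ : ℝ) : minorant η a c B θ = θ ^ 2 / 2 *
    ((1 - η - B * θ ^ 6) * exp (-a * θ ^ 2) - B * θ ^ 6 / 2 * exp (-c * θ ^ 2)) := by
  rw [minorant]; ring

theorem integrableOn_minorant (η B : ℝ) {a c : ℝ} (ha : 0 < a) (hc : 0 < c) :
    IntegrableOn (minorant η a c B) (Set.Ioi 0) :=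
  (((integrableOn_pow_mul_exp_neg_mul_sq 2 ha).const_mul _).sub
    ((integrableOn_pow_mul_exp_neg_mul_sq 8 ha).const_mul _)).sub
    ((integrableOn_pow_mul_exp_neg_mul_sq 8 hc).const_mul _)

theorem integral_minorant (η B : ℝ) {a c : ℝ} (ha : 0 < a) (hc : 0 < c) :
    ∫ θ in Set.Ioi 0, minorant η a c B θ = √π * ((1 - η) / (8 * (a * √a)) -
      105 * B / (64 * (a ^ 4 * √a)) - 105 * B / (128 * (c ^ 4 * √c))) := by
  have h1 := (integrableOn_pow_mul_exp_neg_mul_sq 2 ha).const_mul ((1 - η) / 2)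
  have h2 := (integrableOn_pow_mul_exp_neg_mul_sq 8 ha).const_mul (B / 2)
  have h3 := (integrableOn_pow_mul_exp_neg_mul_sq 8 hc).const_mul (B / 4)
  simp only [minorant]
  have h12 := integral_sub (h1.sub h2) h3
  simp only [Pi.sub_apply] at h12
  rw [h12, integral_sub h1 h2,
    integral_const_mul, integral_const_mul,
    integral_const_mul, integral_sq_mul_exp_neg_mul_sq ha,
    integral_pow_eight_mul_exp_neg_mul_sq ha, integral_pow_eight_mul_exp_neg_mul_sq hc]
  field_simp
  ring

theorem minorant_nonpos {η a c B θ : ℝ} (hη : 0 ≤ η) (hB : 1 ≤ B * θ ^ 6) :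
    minorant η a c B θ ≤ 0 := by
  rw [minorant_eq]
  refine mul_nonpos_of_nonneg_of_nonpos (by positivity) ?_
  have h1 := mul_nonneg (sub_nonneg.2 hB) (exp_pos (-a * θ ^ 2)).le
  have h2 := mul_nonneg hη (exp_pos (-a * θ ^ 2)).le
  have h3 := mul_pos (zero_lt_one.trans_le hB) (exp_pos (-c * θ ^ 2))
  linarith

theorem integral_Ioi_minorant_le {η a c B b : ℝ} (hη : 0 ≤ η) (ha : 0 < a) (hc : 0 < c)
    (hb : 0 ≤ b) (hB0 : 0 ≤ B) (hB : 1 ≤ B * b ^ 6) :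
    ∫ θ in Set.Ioi 0, minorant η a c B θ ≤ ∫ θ in 0..b, minorant η a c B θ := by
  have hi := integrableOn_minorant η B ha hc
  have h := intervalIntegral.integral_interval_add_Ioi hi
    (hi.mono_set (Set.Ioi_subset_Ioi hb))
  have h2 : ∫ θ in Set.Ioi b, minorant η a c B θ ≤ 0 :=
    setIntegral_nonpos measurableSet_Ioi fun θ hθ ↦ minorant_nonpos hη <|
      hB.trans <| by
        have : b ≤ θ := (Set.mem_Ioi.1 hθ).le
        gcongr
  linarith

theorem minorant_le {η a c B θ E Φ t : ℝ} (hη : 0 ≤ η) (hη1 : η ≤ 1) (hE : E ≤ a * θ ^ 2)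
    (hE' : c * θ ^ 2 ≤ E) (hΦ : Φ ^ 2 / 2 ≤ B * θ ^ 6) (ht : θ ^ 2 / 2 * (1 - η) ≤ t)
    (ht' : t ≤ θ ^ 2 / 2) : minorant η a c B θ ≤ exp (-E) * cos Φ * t := by
  have hcos := one_sub_sq_div_two_le_cos (x := Φ)
  have hcos' := neg_one_le_cos Φ
  rw [minorant_eq]
  set Q := B * θ ^ 6
  set u := θ ^ 2 / 2 with hu
  have hu0 : 0 ≤ u := by positivity
  have hQ0 : 0 ≤ Q := le_trans (by positivity) hΦ
  have h1 : exp (-a * θ ^ 2) ≤ exp (-E) := exp_le_exp.2 (by linarith)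
  have h2 : exp (-E) ≤ exp (-c * θ ^ 2) := exp_le_exp.2 (by linarith)
  have ea := exp_pos (-a * θ ^ 2)
  have ec := exp_pos (-c * θ ^ 2)
  have eE := exp_pos (-E)
  have ht0 : 0 ≤ t := le_trans (mul_nonneg hu0 (by linarith)) ht
  rcases le_or_gt Q 1 with hQ | hQ
  · calc _ ≤ exp (-a * θ ^ 2) * (1 - Q) * (u * (1 - η)) := by
          have e1 : 0 ≤ u * (Q / 2 * exp (-c * θ ^ 2)) := by positivity
          have e2 : 0 ≤ u * (exp (-a * θ ^ 2) * (η * Q)) := by positivity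
          linarith
      _ ≤ exp (-E) * (1 - Q) * t := by
          have : 0 ≤ 1 - Q := by linarith
          have : 0 ≤ 1 - η := by linarith
          gcongr
      _ ≤ _ := by
          gcongr
          linarith
  · calc _ ≤ -(u * (Q / 2 * exp (-c * θ ^ 2))) := by
          have : u * ((1 - η - Q) * exp (-a * θ ^ 2)) ≤ 0 :=
            mul_nonpos_of_nonneg_of_nonpos hu0
              (mul_nonpos_of_nonpos_of_nonneg (by linarith) ea.le)
          linarith
      _ ≤ -(t * (Q / 2 * exp (-E))) := by
          rw [neg_le_neg_iff]
          gcongr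
      _ ≤ _ := by
          have : -(Q / 2) ≤ cos Φ := by
            rcases le_or_gt Q 2 with h | h <;> linarith
          have := mul_le_mul_of_nonneg_left this (mul_nonneg eE.le ht0)
          linarith


/-- The integrand whose positivity is equivalent to the inequality between the coefficients. -/
noncomputable def kernelIntegrand (s N θ : ℝ) : ℝ :=
  exp (-decay s θ) * cos (phase s θ - N * θ) * (1 - cos θ)

theorem continuous_kernelIntegrand {s : ℝ} (hs : 0 < s) (N : ℝ) :
    Continuous (kernelIntegrand s N) := by
  have h1 := continuous_decay hs
  have h2 := continuous_phase hs
  unfold kernelIntegrand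
  fun_prop

theorem neg_le_kernelIntegrand {s N θ d t : ℝ} (hd : d ≤ decay s θ) (ht : 1 - cos θ ≤ t) :
    -(exp (-d) * t) ≤ kernelIntegrand s N θ := by
  have h0 : 0 ≤ 1 - cos θ := sub_nonneg.2 (cos_le_one θ)
  have h1 : exp (-decay s θ) ≤ exp (-d) := exp_le_exp.2 (neg_le_neg hd)
  have h2 := neg_one_le_cos (phase s θ - N * θ)
  calc -(exp (-d) * t) ≤ -(exp (-decay s θ) * (1 - cos θ)) := by
        rw [neg_le_neg_iff]
        gcongr
    _ ≤ _ := by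
        have := mul_le_mul_of_nonneg_left h2 (mul_nonneg (exp_pos (-decay s θ)).le h0)
        rw [kernelIntegrand]
        linarith

theorem neg_mul_le_integral_kernelIntegrand {s N x y C : ℝ} (hs : 0 < s) (hxy : x ≤ y)
    (h : ∀ θ ∈ Set.Icc x y, -C ≤ kernelIntegrand s N θ) :
    -(C * (y - x)) ≤ ∫ θ in x..y, kernelIntegrand s N θ := by
  have := intervalIntegral.integral_mono_on hxy (f := fun _ ↦ -C) (μ := volume)
    intervalIntegrable_const ((continuous_kernelIntegrand hs N).intervalIntegrable _ _) h
  rw [intervalIntegral.integral_const, smul_eq_mul] at this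
  linarith

theorem minorant_le_kernelIntegrand {s N θ : ℝ} (hs : 0 < s) (hs1 : s ≤ 1 / 49)
    (hN : ∑' p, weight s p * freq p = N) (hθ : 0 ≤ θ) (hθs : θ ≤ s / 2) :
    minorant 0.0001 (1.645 / s ^ 3) (0.96 / s ^ 3) (1.842 / s ^ 8) θ ≤ kernelIntegrand s N θ := by
  have hsq : θ ^ 2 ≤ s ^ 2 / 4 := by nlinarith
  refine minorant_le (by norm_num) (by norm_num) ((decay_le hs θ).trans ?_) ?_ ?_ ?_ ?_
  · have := pi_sq_div_six_lt
    gcongr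
  · refine le_trans ?_ (le_decay_of_le hs hs1 (by rw [abs_of_nonneg hθ]; linarith))
    have : θ ^ 2 / (1.25 * s ^ 2) ≤ θ ^ 2 / (s ^ 2 + θ ^ 2) := by
      gcongr
      linarith
    have := mul_le_mul_of_nonneg_left this (show 0 ≤ 1.2 / s by positivity)
    refine le_trans (le_of_eq ?_) this
    field_simp
    ring
  · have h := abs_phase_sub_le hs hθ
    rw [hN] at h
    have h2 : |phase s θ - N * θ| ≤ 1.9192 * (θ ^ 3 / s ^ 4) := by
      refine h.trans ?_
      have h3 := mul_le_mul_of_nonneg_right pi_sq_div_six_lt.le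
        (show 0 ≤ 7 / 6 * (θ ^ 3 / s ^ 4) by positivity)
      have h4 : 0 ≤ θ ^ 3 / s ^ 4 := by positivity
      have e : 7 / s ^ 4 * (π ^ 2 / 6) * (θ ^ 3 / 6) =
        π ^ 2 / 6 * (7 / 6 * (θ ^ 3 / s ^ 4)) := by ring
      rw [e]
      linarith
    have h3 := sq_le_sq' (by linarith [abs_nonneg (phase s θ - N * θ)]) h2
    rw [sq_abs] at h3
    have h4 : 0 ≤ θ ^ 6 / s ^ 8 := by positivity
    have e : (1.9192 * (θ ^ 3 / s ^ 4)) ^ 2 = 1.9192 ^ 2 * (θ ^ 6 / s ^ 8) := by ring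
    have e2 : 1.842 / s ^ 8 * θ ^ 6 = 1.842 * (θ ^ 6 / s ^ 8) := by ring
    rw [e] at h3
    rw [e2]
    linarith
  · have hθ1 : θ ≤ 1 / 98 := by linarith
    have h := (abs_le.1 (cos_bound (x := θ) (by rw [abs_of_nonneg hθ]; linarith))).2
    rw [abs_of_nonneg hθ] at h
    have h2 : θ ^ 2 ≤ 1 / 98 ^ 2 := by nlinarith
    have h3 : θ ^ 4 ≤ θ ^ 2 * (1 / 98 ^ 2) := by
      calc θ ^ 4 = θ ^ 2 * θ ^ 2 := by ring
        _ ≤ _ := by gcongr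
    linarith [sq_nonneg θ]
  · linarith [one_sub_sq_div_two_le_cos (x := θ)]

theorem integral_minorant_ge {X : ℝ} (hX : 49 ≤ X) : 0.3864 / (X ^ 4 * (X + 49)) ≤
    ∫ θ in Set.Ioi 0, minorant 0.0001 (1.645 * X ^ 3) (0.96 * X ^ 3) (1.842 * X ^ 8) θ := by
  have hX0 : 0 < X := by linarith
  rw [integral_minorant _ _ (by positivity) (by positivity)]
  have hr0 : 0 < √X := sqrt_pos.2 hX0
  have hr2 : √X ^ 2 = X := sq_sqrt hX0.le
  have hX3 : √(X ^ 3) = X * √X := by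
    rw [pow_succ, sqrt_mul (by positivity), sqrt_sq hX0.le]
  have hr : √X ≤ (X + 49) / 14 := by nlinarith [sq_nonneg (√X - 7)]
  rw [sqrt_mul (by norm_num), sqrt_mul (by norm_num), hX3]
  have hα : √1.645 ≤ 1.2826 := sqrt_le_iff.2 (by norm_num)
  have hα0 : 0 < √1.645 := sqrt_pos.2 (by norm_num)
  have hγ0 : 0.9797 ≤ √0.96 := le_sqrt_of_sq_le (by norm_num)
  have hρ : 1.7724 ≤ √π := le_sqrt_of_sq_le (by linarith [pi_gt_d4])
  set r := √X
  set α := √1.645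
  set γ := √0.96
  have hγ : (0 : ℝ) < γ := by linarith
  have hγα : 1 / γ ≤ 1.3092 / α := by
    rw [div_le_div_iff₀ hγ hα0]
    linarith
  have hρα : 1.381 ≤ √π / α := by
    rw [le_div_iff₀ hα0]
    linarith
  have key : 0.02 / (α * (X ^ 4 * r)) ≤
      (1 - 0.0001) / (8 * (1.645 * X ^ 3 * (α * (X * r)))) -
      105 * (1.842 * X ^ 8) / (64 * ((1.645 * X ^ 3) ^ 4 * (α * (X * r)))) -
      105 * (1.842 * X ^ 8) / (128 * ((0.96 * X ^ 3) ^ 4 * (γ * (X * r)))) := by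
    have e1 : (1 - 0.0001) / (8 * (1.645 * X ^ 3 * (α * (X * r)))) =
        (0.9999 / 13.16) * (1 / (α * (X ^ 4 * r))) := by
      field_simp; norm_num
    have e2 : 105 * (1.842 * X ^ 8) / (64 * ((1.645 * X ^ 3) ^ 4 * (α * (X * r)))) =
        (105 * 1.842 / (64 * 1.645 ^ 4)) * (1 / X) * (1 / (α * (X ^ 4 * r))) := by
      field_simp
    have e3 : 105 * (1.842 * X ^ 8) / (128 * ((0.96 * X ^ 3) ^ 4 * (γ * (X * r)))) =
        (105 * 1.842 / (128 * 0.96 ^ 4)) * (1 / X) * ((1 / γ) * (1 / (X ^ 4 * r))) := by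
      field_simp
    have e4 : 1 / γ * (1 / (X ^ 4 * r)) ≤ 1.3092 * (1 / (α * (X ^ 4 * r))) := by
      calc _ ≤ 1.3092 / α * (1 / (X ^ 4 * r)) := by gcongr
        _ = _ := by field_simp
    have hP : 0 < 1 / (α * (X ^ 4 * r)) := by positivity
    have hXi : 1 / X ≤ 1 / 49 := by gcongr
    have hXi0 : 0 < 1 / X := by positivity
    rw [e1, e2, e3, div_eq_mul_one_div 0.02]
    set P := 1 / (α * (X ^ 4 * r))
    have e5 : 105 * 1.842 / (128 * 0.96 ^ 4) * (1 / X) * (1 / γ * (1 / (X ^ 4 * r))) ≤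
        105 * 1.842 / (128 * 0.96 ^ 4) * (1 / X) * (1.3092 * P) := by gcongr
    have e6 := mul_le_mul_of_nonneg_right hXi hP.le
    linarith
  calc 0.3864 / (X ^ 4 * (X + 49)) = 0.0276 / (X ^ 4 * ((X + 49) / 14)) := by
        field_simp; norm_num
    _ ≤ 0.0276 / (X ^ 4 * r) := by gcongr
    _ = 1.38 * (0.02 / (X ^ 4 * r)) := by ring
    _ ≤ √π / α * (0.02 / (X ^ 4 * r)) := by
        gcongr
        linarith
    _ = √π * (0.02 / (α * (X ^ 4 * r))) := by field_simp
    _ ≤ _ := by gcongr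

theorem exp_tail_lt {X : ℝ} (hX : 49 ≤ X) :
    3 / X ^ 3 * exp (-(0.24 * X)) + 6.3 * exp (-(0.55 * X)) < 0.3864 / (X ^ 4 * (X + 49)) := by
  obtain ⟨y, hy, rfl⟩ : ∃ y, 0 ≤ y ∧ X = y + 49 := ⟨X - 49, by linarith, by ring⟩
  have hX0 : 0 < y + 49 := by linarith
  have h1 : (y + 49) * (y + 98) * exp (-(0.24 * (y + 49))) ≤ 0.0834 := by
    rw [exp_neg, mul_inv_le_iff₀ (exp_pos _)]
    have e1 : exp (0.24 * (y + 49)) = exp 1 ^ 11 * exp (0.24 * y + 0.76) := by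
      rw [← exp_nat_mul, ← exp_add]
      congr 1
      push_cast
      ring
    have e2 : (59000 : ℝ) ≤ exp 1 ^ 11 := by
      calc (59000 : ℝ) ≤ 2.718 ^ 11 := by norm_num
        _ ≤ _ := by
          have := exp_one_gt_d9
          gcongr
          linarith
    have e3 := quadratic_le_exp_of_nonneg (x := 0.24 * y + 0.76) (by linarith)
    have e4 : 59000 * (1 + (0.24 * y + 0.76) + (0.24 * y + 0.76) ^ 2 / 2) ≤
        exp 1 ^ 11 * exp (0.24 * y + 0.76) := by gcongr
    rw [e1]
    nlinarith
  have h2 : (y + 49) * exp (-(0.11 * (y + 49))) ≤ 0.38 := by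
    rw [exp_neg, mul_inv_le_iff₀ (exp_pos _)]
    have e1 : exp (0.11 * (y + 49)) = exp 1 ^ 5 * exp (0.11 * y + 0.39) := by
      rw [← exp_nat_mul, ← exp_add]
      congr 1
      push_cast
      ring
    have e2 : (148 : ℝ) ≤ exp 1 ^ 5 := by
      calc (148 : ℝ) ≤ 2.718 ^ 5 := by norm_num
        _ ≤ _ := by
          have := exp_one_gt_d9
          gcongr
          linarith
    have e3 := add_one_le_exp (0.11 * y + 0.39)
    have e4 : 148 * (0.11 * y + 0.39 + 1) ≤ exp 1 ^ 5 * exp (0.11 * y + 0.39) := by gcongr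
    rw [e1]
    linarith
  have h3 : (y + 49) ^ 5 * exp (-(0.55 * (y + 49))) ≤ 0.008 := by
    calc _ = ((y + 49) * exp (-(0.11 * (y + 49)))) ^ 5 := by
          rw [mul_pow, ← exp_nat_mul]
          congr 2
          push_cast
          ring
      _ ≤ 0.38 ^ 5 := by gcongr
      _ ≤ _ := by norm_num
  rw [lt_div_iff₀ (by positivity)]
  have h4 : (y + 49) ^ 4 * (y + 49 + 49) * exp (-(0.55 * (y + 49))) ≤
      2 * ((y + 49) ^ 5 * exp (-(0.55 * (y + 49)))) := by
    have : (y + 49) ^ 4 * (y + 49 + 49) ≤ 2 * (y + 49) ^ 5 := by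
      have : 0 ≤ (y + 49) ^ 4 * y := by positivity
      linarith
    linarith [mul_le_mul_of_nonneg_right this (exp_pos (-(0.55 * (y + 49)))).le]
  calc _ = 3 * ((y + 49) * (y + 98) * exp (-(0.24 * (y + 49)))) +
        6.3 * ((y + 49) ^ 4 * (y + 49 + 49) * exp (-(0.55 * (y + 49)))) := by
        field_simp
        ring
    _ < _ := by linarith

theorem integral_kernelIntegrand_pos {s N : ℝ} (hs : 0 < s) (hs1 : s ≤ 1 / 49)
    (hN : ∑' p, weight s p * freq p = N) : 0 < ∫ θ in 0..π, kernelIntegrand s N θ := by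
  have hi (x y : ℝ) : IntervalIntegrable (kernelIntegrand s N) volume x y :=
    (continuous_kernelIntegrand hs N).intervalIntegrable _ _
  have hπ := pi_gt_three
  have hπ' := pi_lt_d2
  rw [← intervalIntegral.integral_add_adjacent_intervals (hi 0 (s / 2)) (hi (s / 2) π),
    ← intervalIntegral.integral_add_adjacent_intervals (hi (s / 2) (2 * s)) (hi (2 * s) π)]
  obtain ⟨X, rfl⟩ : ∃ X, s = 1 / X := ⟨1 / s, by simp⟩
  have hX0 : 0 < X := one_div_pos.1 hs
  have hX : 49 ≤ X := (one_div_le_one_div hX0 (by norm_num)).1 hs1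
  have h1 : 0.3864 / (X ^ 4 * (X + 49)) ≤ ∫ θ in 0..1 / X / 2, kernelIntegrand (1 / X) N θ := by
    have e (c : ℝ) (k : ℕ) : c / (1 / X) ^ k = c * X ^ k := by
      rw [one_div, inv_pow, div_inv_eq_mul]
    have hB : 1 ≤ 1.842 * X ^ 8 * (1 / X / 2) ^ 6 := by
      have : 1.842 * X ^ 8 * (1 / X / 2) ^ 6 = 1.842 / 64 * X ^ 2 := by
        field_simp
        norm_num
      rw [this]
      nlinarith
    refine (integral_minorant_ge hX).trans ((integral_Ioi_minorant_le (by norm_num)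
      (by positivity) (by positivity) (by positivity) (by positivity) hB).trans ?_)
    refine intervalIntegral.integral_mono_on (by positivity) ?_ (hi _ _) fun θ hθ ↦ ?_
    · rw [intervalIntegrable_iff_integrableOn_Ioc_of_le (by positivity)]
      exact (integrableOn_minorant _ _ (by positivity) (by positivity)).mono_set
        Set.Ioc_subset_Ioi_self
    · have := minorant_le_kernelIntegrand hs hs1 hN hθ.1 hθ.2
      rwa [e, e, e] at this
  have h2 := neg_mul_le_integral_kernelIntegrand (N := N) (x := 1 / X / 2) (y := 2 * (1 / X))
    (C := exp (-(0.24 * X)) * (2 * (1 / X) ^ 2)) hs (by linarith) fun θ hθ ↦ by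
      have hθ0 : 0 < θ := lt_of_lt_of_le (by positivity) hθ.1
      refine neg_le_kernelIntegrand ?_ ?_
      · refine le_trans ?_ (le_decay_of_le hs hs1 (by rw [abs_of_pos hθ0]; exact hθ.2))
        have h : 1 / 5 ≤ θ ^ 2 / ((1 / X) ^ 2 + θ ^ 2) := by
          rw [div_le_div_iff₀ (by norm_num) (by positivity)]
          nlinarith [hθ.1]
        have e : 1.2 / (1 / X) = 1.2 * X := by field_simp
        rw [e]
        nlinarith
      · have := one_sub_sq_div_two_le_cos (x := θ)
        nlinarith [hθ.2]
  have h3 := neg_mul_le_integral_kernelIntegrand (N := N) (x := 2 * (1 / X)) (y := π)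
    (C := exp (-(0.55 * X)) * 2) hs (by linarith) fun θ hθ ↦ by
      refine neg_le_kernelIntegrand ?_ (by linarith [neg_one_le_cos θ])
      have := le_decay_of_ge hs hs1 hθ.1 hθ.2
      rwa [show 0.55 / (1 / X) = 0.55 * X by field_simp] at this
  have h4 := exp_tail_lt hX
  have e2 : exp (-(0.24 * X)) * (2 * (1 / X) ^ 2) * (2 * (1 / X) - 1 / X / 2) =
      3 / X ^ 3 * exp (-(0.24 * X)) := by
    field_simp
    ring
  have e3 : exp (-(0.55 * X)) * 2 * (π - 2 * (1 / X)) ≤ 6.3 * exp (-(0.55 * X)) := by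
    have h := exp_pos (-(0.55 * X))
    nlinarith
  linarith

end Positivity

section Evaluation

/-- The power series `f` converges absolutely at `z`, with value `v`. -/
def EvalsTo (f : PowerSeries ℂ) (z v : ℂ) : Prop :=
  Summable (fun n ↦ ‖PowerSeries.coeff n f * z ^ n‖) ∧
    HasSum (fun n ↦ PowerSeries.coeff n f * z ^ n) v

theorem evalsTo_one (z : ℂ) : EvalsTo 1 z 1 := by
  have h : ∀ n ∉ ({0} : Finset ℕ), PowerSeries.coeff n (1 : PowerSeries ℂ) * z ^ n = 0 := by
    intro n hn
    rw [mem_singleton] at hn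
    simp [PowerSeries.coeff_one, hn]
  refine ⟨summable_of_ne_finset_zero (s := {0}) fun n hn ↦ by rw [h n hn, norm_zero], ?_⟩
  simpa using hasSum_sum_of_ne_finset_zero h

theorem EvalsTo.mul {f g : PowerSeries ℂ} {z v w : ℂ} (hf : EvalsTo f z v) (hg : EvalsTo g z w) :
    EvalsTo (f * g) z (v * w) := by
  have e (n : ℕ) : PowerSeries.coeff n (f * g) * z ^ n = ∑ p ∈ antidiagonal n,
      PowerSeries.coeff p.1 f * z ^ p.1 * (PowerSeries.coeff p.2 g * z ^ p.2) := by
    rw [PowerSeries.coeff_mul, sum_mul]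
    refine sum_congr rfl fun p hp ↦ ?_
    rw [← mem_antidiagonal.1 hp, pow_add]
    ring
  have h1 := summable_norm_sum_mul_antidiagonal_of_summable_norm hf.1 hg.1
  simp only [EvalsTo, e]
  refine ⟨h1, ?_⟩
  rw [← hf.2.tsum_eq, ← hg.2.tsum_eq,
    tsum_mul_tsum_eq_tsum_sum_antidiagonal_of_summable_norm hf.1 hg.1]
  exact h1.of_norm.hasSum

theorem EvalsTo.prod {ι : Type*} {f : ι → PowerSeries ℂ} {z : ℂ} {v : ι → ℂ} (S : Finset ι)
    (h : ∀ i ∈ S, EvalsTo (f i) z (v i)) : EvalsTo (∏ i ∈ S, f i) z (∏ i ∈ S, v i) := by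
  classical
  induction S using Finset.induction_on with
  | empty => exact evalsTo_one z
  | insert i S hi ih =>
    rw [prod_insert hi, prod_insert hi]
    exact (h i (mem_insert_self i S)).mul (ih fun j hj ↦ h j (mem_insert_of_mem hj))

theorem evalsTo_geoSeries {k : ℕ} (hk : 0 < k) {z : ℂ} (hz : ‖z‖ < 1) :
    EvalsTo (geoSeries ℂ k) z (1 - z ^ k)⁻¹ := by
  have hzk : ‖z ^ k‖ < 1 := by
    rw [norm_pow]
    exact pow_lt_one₀ (norm_nonneg z) hz hk.ne'
  simp only [EvalsTo, geoSeries, PowerSeries.coeff_mk]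
  constructor
  · refine Summable.of_nonneg_of_le (fun n ↦ norm_nonneg _) (fun n ↦ ?_)
      (summable_geometric_of_lt_one (norm_nonneg z) hz)
    split_ifs <;> simp
  · have hinj : Function.Injective fun n : ℕ ↦ k * n := fun a b h ↦ Nat.eq_of_mul_eq_mul_left hk h
    refine (hinj.hasSum_iff fun n hn ↦ ?_).1 ?_
    · rw [if_neg, zero_mul]
      rintro ⟨m, rfl⟩
      exact hn ⟨m, rfl⟩
    · convert! hasSum_geometric_of_norm_lt_one hzk using 1
      ext n
      simp [pow_mul]

theorem evalsTo_cardParts (M : ℕ) {z : ℂ} (hz : ‖z‖ < 1) :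
    EvalsTo (PowerSeries.mk fun n ↦ (cardParts (M + 1) n : ℂ)) z
      (∏ k ∈ range M, (1 - z ^ (k + 2))⁻¹) := by
  rw [mk_cardParts, prod_Ico_eq_prod_range]
  refine EvalsTo.prod _ fun k _ ↦ ?_
  rw [show 1 + k + 1 = k + 2 by ring]
  exact evalsTo_geoSeries (by lia) hz

theorem norm_exp_neg_mul_cexp_lt_one {s : ℝ} (hs : 0 < s) (θ : ℝ) :
    ‖(exp (-s) : ℂ) * Complex.exp (θ * Complex.I)‖ < 1 := by
  rw [norm_mul, Complex.norm_exp_ofReal_mul_I, mul_one, Complex.norm_real]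
  exact norm_exp_neg_lt_one hs

theorem integral_cos_int_mul (m : ℤ) :
    ∫ θ in 0..π, cos (m * θ) = if m = 0 then π else 0 := by
  split_ifs with h
  · simp [h]
  · rw [intervalIntegral.integral_comp_mul_left _ (Int.cast_ne_zero.2 h), integral_cos]
    simp [sin_int_mul_pi]

theorem integral_cos_int_mul_one_sub_cos (m : ℤ) :
    ∫ θ in 0..π, cos (m * θ) * (1 - cos θ) =
      if m = 0 then π else if m = 1 ∨ m = -1 then -π / 2 else 0 := by
  have hi (m : ℤ) (c : ℝ) : IntervalIntegrable (fun θ ↦ cos (m * θ) * c)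
      MeasureTheory.volume 0 π :=
    Continuous.intervalIntegrable (by fun_prop) _ _
  have e (θ : ℝ) : cos (m * θ) * (1 - cos θ) =
      cos (m * θ) * 1 - (cos (((m + 1 : ℤ) : ℝ) * θ) * (1 / 2) +
        cos (((m - 1 : ℤ) : ℝ) * θ) * (1 / 2)) := by
    have h1 := cos_add (m * θ) θ
    have h2 := cos_sub (m * θ) θ
    push_cast
    rw [add_mul, sub_mul, one_mul, h1, h2]
    ring
  simp_rw [e]
  rw [intervalIntegral.integral_sub (hi _ _) ((hi _ _).add (hi _ _)),
    intervalIntegral.integral_add (hi _ _) (hi _ _)]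
  simp only [intervalIntegral.integral_mul_const, integral_cos_int_mul]
  split_ifs <;> first | lia | ring

theorem integral_series {a : ℕ → ℝ} (ha : Summable fun n ↦ ‖a n‖) {f : ℝ → ℝ} {N : ℕ}
    (hN : 1 ≤ N) (hf : ∀ θ, HasSum (fun n ↦ a n * cos (((n : ℤ) - N : ℤ) * θ)) (f θ)) :
    ∫ θ in 0..π, f θ * (1 - cos θ) = π * (a N - a (N - 1) / 2 - a (N + 1) / 2) := by
  have h := intervalIntegral.hasSum_integral_of_dominated_convergence
    (F := fun n θ ↦ a n * (cos (((n : ℤ) - N : ℤ) * θ) * (1 - cos θ)))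
    (f := fun θ ↦ f θ * (1 - cos θ)) (a := 0) (b := π) (μ := MeasureTheory.volume)
    (fun n _ ↦ ‖a n‖ * 2) (fun n ↦ Continuous.aestronglyMeasurable (by fun_prop))
    (fun n ↦ Filter.Eventually.of_forall fun θ _ ↦ by
      rw [norm_mul, norm_mul, norm_eq_abs (cos _), norm_eq_abs (1 - cos θ)]
      have h1 := abs_cos_le_one (((n : ℤ) - N : ℤ) * θ)
      have h2 : |1 - cos θ| ≤ 2 := by
        rw [abs_of_nonneg (sub_nonneg.2 (cos_le_one θ))]
        linarith [neg_one_le_cos θ]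
      have h3 := mul_le_mul h1 h2 (abs_nonneg _) zero_le_one
      rw [one_mul] at h3
      exact mul_le_mul_of_nonneg_left h3 (norm_nonneg _))
    (Filter.Eventually.of_forall fun θ _ ↦ ha.mul_right 2) intervalIntegrable_const
    (Filter.Eventually.of_forall fun θ _ ↦ by
      simpa only [mul_assoc] using (hf θ).mul_right (1 - cos θ))
  simp only [intervalIntegral.integral_const_mul, integral_cos_int_mul_one_sub_cos] at h
  rw [h.unique (hasSum_sum_of_ne_finset_zero (s := {N, N - 1, N + 1}) fun n hn ↦ ?_)]
  · rw [sum_insert (by simp; lia), sum_insert (by simp), sum_singleton,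
      if_pos (by lia), if_neg (by lia), if_pos (by lia), if_neg (by lia), if_pos (by lia)]
    ring
  · simp only [mem_insert, mem_singleton, not_or] at hn
    rw [if_neg (by lia), if_neg (by lia), mul_zero]

/-- The generating function of `cardParts (M + 1)` at `exp (-s + θ * I)`, divided by its value at
`exp (-s)`. -/
noncomputable def genRatio (s : ℝ) (M : ℕ) (θ : ℝ) : ℂ := ∏ k ∈ range M,
  (1 - (exp (-s) : ℂ) ^ (k + 2)) / (1 - ((exp (-s) : ℂ) * Complex.exp (θ * Complex.I)) ^ (k + 2))

theorem one_sub_pow_ne_zero {z : ℂ} (hz : ‖z‖ < 1) (k : ℕ) : 1 - z ^ (k + 2) ≠ 0 := by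
  intro h
  have h1 : ‖z ^ (k + 2)‖ < 1 := by
    rw [norm_pow]
    exact pow_lt_one₀ (norm_nonneg z) hz (by lia)
  rw [← sub_eq_zero.1 h, norm_one] at h1
  exact lt_irrefl _ h1

theorem continuous_genRatio {s : ℝ} (hs : 0 < s) (M : ℕ) : Continuous (genRatio s M) := by
  unfold genRatio
  refine continuous_finsetProd _ fun k _ ↦ Continuous.div (by fun_prop) (by fun_prop) fun θ ↦ ?_
  exact one_sub_pow_ne_zero (norm_exp_neg_mul_cexp_lt_one hs θ) k

theorem norm_genRatio_le {s : ℝ} (hs : 0 < s) (M : ℕ) (θ : ℝ) : ‖genRatio s M θ‖ ≤ 1 := by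
  rw [genRatio, norm_prod]
  refine prod_le_one (fun _ _ ↦ norm_nonneg _) fun k _ ↦ ?_
  have hz := norm_exp_neg_mul_cexp_lt_one hs θ
  rw [norm_div, div_le_one (norm_pos_iff.2 (one_sub_pow_ne_zero hz k))]
  have h1 : ‖1 - (exp (-s) : ℂ) ^ (k + 2)‖ = 1 - exp (-s) ^ (k + 2) := by
    have : 0 ≤ 1 - exp (-s) ^ (k + 2) :=
      sub_nonneg.2 (pow_le_one₀ (exp_pos _).le (exp_le_one_iff.2 (by linarith)))
    rw [← Complex.norm_of_nonneg this]
    push_cast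
    rfl
  have h2 := norm_sub_norm_le 1 (((exp (-s) : ℂ) * Complex.exp (θ * Complex.I)) ^ (k + 2))
  rw [norm_one, norm_pow, norm_mul, Complex.norm_exp_ofReal_mul_I, mul_one,
    Complex.norm_of_nonneg (exp_pos _).le] at h2
  rw [h1]
  exact_mod_cast h2

theorem integral_genRatio {s : ℝ} (hs : 0 < s) (M : ℕ) {N : ℕ} (hN : 1 ≤ N) :
    ∃ C : ℝ, 0 < C ∧
      ∫ θ in 0..π, (genRatio s M θ * Complex.exp (-(N * θ) * Complex.I)).re * (1 - cos θ) =
        C * (cardParts (M + 1) N * exp (-s) ^ N -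
          cardParts (M + 1) (N - 1) * exp (-s) ^ (N - 1) / 2 -
          cardParts (M + 1) (N + 1) * exp (-s) ^ (N + 1) / 2) := by
  have hC (k : ℕ) : 0 < 1 - exp (-s) ^ (k + 2) :=
    sub_pos.2 (pow_lt_one₀ (exp_pos _).le (exp_neg_lt_one hs) (by lia))
  set C : ℝ := ∏ k ∈ range M, (1 - exp (-s) ^ (k + 2)) with hCdef
  have hC0 : 0 < C := prod_pos fun k _ ↦ hC k
  have hr (θ : ℝ) : genRatio s M θ = C * ∏ k ∈ range M,
      (1 - ((exp (-s) : ℂ) * Complex.exp (θ * Complex.I)) ^ (k + 2))⁻¹ := by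
    rw [genRatio, hCdef]
    push_cast
    rw [← prod_mul_distrib]
    rfl
  have hsum (θ : ℝ) := (evalsTo_cardParts M (norm_exp_neg_mul_cexp_lt_one hs θ))
  simp only [EvalsTo, PowerSeries.coeff_mk] at hsum
  refine ⟨C * π, by positivity, ?_⟩
  rw [integral_series (a := fun n ↦ C * (cardParts (M + 1) n * exp (-s) ^ n)) (N := N) ?_ hN ?_]
  · ring
  · have h := ((hsum 0).1).mul_left C
    refine h.congr fun n ↦ ?_
    rw [norm_mul, norm_mul, norm_mul, norm_eq_abs C, abs_of_pos hC0, norm_pow, norm_pow, norm_mul,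
      Complex.norm_exp_ofReal_mul_I, mul_one, Complex.norm_real,
      Complex.norm_natCast, norm_natCast]
  · intro θ
    have h := Complex.hasSum_re (((hsum θ).2.mul_left (C : ℂ)).mul_right
      (Complex.exp (-(N * θ) * Complex.I)))
    rw [← hr] at h
    convert! h using 2 with n
    have e : (C : ℂ) * (cardParts (M + 1) n *
        ((exp (-s) : ℂ) * Complex.exp (θ * Complex.I)) ^ n) *
        Complex.exp (-(N * θ) * Complex.I) =
        ((C * (cardParts (M + 1) n * exp (-s) ^ n) : ℝ) : ℂ) *
          Complex.exp (((((n : ℤ) - N : ℤ) * θ : ℝ) : ℂ) * Complex.I) := by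
      rw [mul_pow, ← Complex.exp_nat_mul]
      push_cast
      rw [show ((n : ℂ) - N) * θ * Complex.I = n * (θ * Complex.I) + -(N * θ) * Complex.I by ring,
        Complex.exp_add]
      ring
    rw [e, Complex.re_ofReal_mul, Complex.exp_ofReal_mul_I_re]

end Evaluation

section Limit

theorem hasSum_pow_div_succ {z : ℂ} (hz : ‖z‖ < 1) :
    HasSum (fun m : ℕ ↦ z ^ (m + 1) / (m + 1)) (-Complex.log (1 - z)) := by
  have h := (hasSum_nat_add_iff' 1).2 (Complex.hasSum_taylorSeries_neg_log hz)
  simpa using h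

theorem hasSum_weight_mul_cexp {s : ℝ} (hs : 0 < s) (θ : ℝ) :
    HasSum (fun p ↦ (weight s p : ℂ) * (Complex.exp ((freq p * θ : ℝ) * Complex.I) - 1))
      (-decay s θ + phase s θ * Complex.I) := by
  have h1 := Complex.hasSum_ofReal.2 (summable_decay hs θ).hasSum
  have h2 := Complex.hasSum_ofReal.2 (summable_phase hs θ).hasSum
  convert! h1.neg.add (h2.mul_right Complex.I) using 1
  ext p
  rw [Complex.exp_mul_I]
  push_cast
  ring

theorem weight_mul_cexp_sub_one (s θ : ℝ) (m k : ℕ) :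
    (weight s (m, k) : ℂ) * (Complex.exp ((freq (m, k) * θ : ℝ) * Complex.I) - 1) =
      (((exp (-s) : ℂ) * Complex.exp (θ * Complex.I)) ^ (k + 2)) ^ (m + 1) / (m + 1) -
        ((exp (-s) : ℂ) ^ (k + 2)) ^ (m + 1) / (m + 1) := by
  have e : (weight s (m, k) : ℂ) = ((exp (-s) : ℂ) ^ (k + 2)) ^ (m + 1) / (m + 1) := by
    rw [weight, ← pow_mul]
    norm_cast
    rw [← exp_nat_mul, freq]
    congr 2
    push_cast
    ring
  have e2 : Complex.exp ((freq (m, k) * θ : ℝ) * Complex.I) =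
      (Complex.exp (θ * Complex.I) ^ (k + 2)) ^ (m + 1) := by
    rw [← pow_mul, ← Complex.exp_nat_mul, freq]
    congr 1
    push_cast
    ring
  rw [e, e2, mul_pow, mul_pow]
  ring

theorem tendsto_genRatio {s : ℝ} (hs : 0 < s) (θ : ℝ) : Tendsto (fun M ↦ genRatio s M θ) atTop
    (𝓝 (Complex.exp (-decay s θ + phase s θ * Complex.I))) := by
  set z := (exp (-s) : ℂ) * Complex.exp (θ * Complex.I) with hzdef
  have hz : ‖z‖ < 1 := norm_exp_neg_mul_cexp_lt_one hs θ
  have hq : ‖(exp (-s) : ℂ)‖ < 1 := by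
    rw [Complex.norm_real]
    exact norm_exp_neg_lt_one hs
  have hpow {w : ℂ} (hw : ‖w‖ < 1) (k : ℕ) : ‖w ^ (k + 2)‖ < 1 := by
    rw [norm_pow]
    exact pow_lt_one₀ (norm_nonneg w) hw (by lia)
  have h := ((Equiv.prodComm ℕ ℕ).hasSum_iff.2 (hasSum_weight_mul_cexp hs θ)).prod_fiberwise
    (g := fun k ↦ -Complex.log (1 - z ^ (k + 2)) -
      -Complex.log (1 - (exp (-s) : ℂ) ^ (k + 2))) fun k ↦ by
    simp only [Function.comp_apply, Equiv.prodComm_apply, Prod.swap_prod_mk,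
      weight_mul_cexp_sub_one]
    exact (hasSum_pow_div_succ (hpow hz k)).sub (hasSum_pow_div_succ (hpow hq k))
  refine ((Complex.continuous_exp.tendsto _).comp h.tendsto_sum_nat).congr fun M ↦ ?_
  rw [Function.comp_apply, Complex.exp_sum, genRatio]
  refine prod_congr rfl fun k _ ↦ ?_
  rw [neg_sub_neg, Complex.exp_sub, Complex.exp_log (one_sub_pow_ne_zero hq k),
    Complex.exp_log (one_sub_pow_ne_zero hz k)]

theorem tendsto_integral_genRatio {s : ℝ} (hs : 0 < s) (N : ℕ) :
    Tendsto (fun M ↦ ∫ θ in 0..π,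
      (genRatio s M θ * Complex.exp (-(N * θ) * Complex.I)).re * (1 - cos θ)) atTop
      (𝓝 (∫ θ in 0..π, kernelIntegrand s N θ)) := by
  refine intervalIntegral.tendsto_integral_filter_of_dominated_convergence (fun _ ↦ 2)
    (Filter.Eventually.of_forall fun M ↦ Continuous.aestronglyMeasurable ?_)
    (Filter.Eventually.of_forall fun M ↦ Filter.Eventually.of_forall fun θ _ ↦ ?_)
    intervalIntegrable_const (Filter.Eventually.of_forall fun θ _ ↦ ?_)
  · have := continuous_genRatio hs M
    fun_prop
  · rw [norm_mul, norm_eq_abs, norm_eq_abs, abs_of_nonneg (sub_nonneg.2 (cos_le_one θ))]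
    have h1 := Complex.abs_re_le_norm (genRatio s M θ * Complex.exp (-(N * θ) * Complex.I))
    have h2 : ‖Complex.exp (-(N * θ) * Complex.I)‖ = 1 := by
      have := Complex.norm_exp_ofReal_mul_I (-(N * θ))
      push_cast at this
      exact this
    rw [norm_mul, h2, mul_one] at h1
    have h3 := mul_le_mul (h1.trans (norm_genRatio_le hs M θ))
      (show 1 - cos θ ≤ 2 by linarith [neg_one_le_cos θ]) (sub_nonneg.2 (cos_le_one θ)) zero_le_one
    linarith
  · have h := ((Complex.continuous_re.tendsto _).comp ((tendsto_genRatio hs θ).mul_const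
      (Complex.exp (-(N * θ) * Complex.I)))).mul_const (1 - cos θ)
    convert! h using 2
    rw [kernelIntegrand, ← Complex.exp_add, show -(decay s θ : ℂ) + phase s θ * Complex.I +
      -(N * θ) * Complex.I = ((-decay s θ : ℝ) : ℂ) +
        ((phase s θ - N * θ : ℝ) : ℂ) * Complex.I by push_cast; ring, Complex.exp_add,
      ← Complex.ofReal_exp, Complex.re_ofReal_mul, Complex.exp_ofReal_mul_I_re]

end Limit

theorem turan_dP_of_ge {n : ℕ} (hn : 4080 ≤ n) : dP n ^ 2 > dP (n - 1) * dP (n + 1) := by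
  have hn' : (4080 : ℝ) ≤ n := by exact_mod_cast hn
  obtain ⟨s, hs, hs1, hsN⟩ := exists_sum_weight_mul_freq_eq (N := (n + 1 : ℕ)) (by
    push_cast
    linarith)
  have hpos := (tendsto_integral_genRatio hs (n + 1)).eventually
    (lt_mem_nhds (integral_kernelIntegrand_pos hs hs1 hsN))
  obtain ⟨M, hM, hMn⟩ := (hpos.and (eventually_ge_atTop (n + 1))).exists
  obtain ⟨C, hC, h⟩ := integral_genRatio hs M (N := n + 1) (by lia)
  rw [h] at hM
  have hlt := pos_of_mul_pos_right hM hC.le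
  rw [dP_eq_cardParts (L := M + 1) (by lia), dP_eq_cardParts (L := M + 1) (n := n - 1) (by lia),
    dP_eq_cardParts (L := M + 1) (n := n + 1) (by lia), Nat.sub_add_cancel (by lia)]
  rw [Nat.add_sub_cancel] at hlt
  rw [gt_iff_lt, ← Int.cast_lt (R := ℝ)]
  push_cast
  set a : ℝ := ((cardParts (M + 1) n : ℕ) : ℝ)
  set b : ℝ := ((cardParts (M + 1) (n + 1) : ℕ) : ℝ)
  set c : ℝ := ((cardParts (M + 1) (n + 1 + 1) : ℕ) : ℝ)
  set q := exp (-s)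
  have hq : 0 < q := exp_pos _
  have ha : 0 ≤ a := Nat.cast_nonneg _
  have hc : 0 ≤ c := Nat.cast_nonneg _
  have e : b * q ^ (n + 1) - a * q ^ n / 2 - c * q ^ (n + 1 + 1) / 2 =
      q ^ n * (b * q - (a + c * q ^ 2) / 2) := by ring
  rw [e] at hlt
  have h2 : (a + c * q ^ 2) / 2 < b * q := sub_pos.1 (pos_of_mul_pos_right hlt (by positivity))
  have h3 : ((a + c * q ^ 2) / 2) ^ 2 < (b * q) ^ 2 := by gcongr
  have h4 : a * c * q ^ 2 < b ^ 2 * q ^ 2 := by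
    linarith [sq_nonneg (a - c * q ^ 2)]
  exact lt_of_mul_lt_mul_right h4 (sq_nonneg q)

theorem turan_dP (n : ℕ) (hn : 71 ≤ n) :
    (dP n) ^ 2 > dP (n - 1) * dP (n + 1) := by
  rcases lt_or_ge n 4080 with h | h
  · exact turan_dP_of_lt hn h
  · exact turan_dP_of_ge h
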